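/- arXiv:2301.09840 — 4 statements merged into one kernel-verified Lean document; each statement's English description precedes it below -/
import Mathlib

section
/- Let G and H be finite groups whose character tables agree except possibly in one row. Precisely, suppose there are distinguished irreducible characters χ₀ of G and ψ₀ of H, a bijection Φ from the set of irreducible characters of G other than χ₀ to the set of irreducible characters of H other than ψ₀, and a bijection σ between the conjugacy classes of G and the conjugacy classes of H, such that χ(c) = Φ(χ)(σ(c)) for every irreducible character χ ≠ χ₀ of G and every conjugacy class c of G. Then the character tables of G and H are identical: there exists a bijection σ' between the conjugacy classes of G and of H such that χ₀(c) = ψ₀(σ'(c)) and χ(c) = Φ(χ)(σ'(c)) for every irreducible character χ ≠ χ₀ of G and every conjugacy class c of G. -/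
open CategoryTheory

/-- `χ : G → ℂ` is the character of an irreducible (simple) finite-dimensional complex
representation of the group `G`. -/
def IsIrrChar (G : Type) [Group G] (χ : G → ℂ) : Prop :=
  ∃ V : FDRep ℂ G, Simple V ∧ FDRep.character V = χ

/-- The value of a class function `χ` on a conjugacy class `c` (via a representative;
this is well-defined for class functions, in particular for irreducible characters). -/
noncomputable def classVal {G : Type} [Group G] (χ : G → ℂ) (c : ConjClasses G) : ℂ :=
  χ (Quotient.out c)

/-- An endomorphism of finite order of a finite-dimensional complex vector space has a basis of
eigenvectors. -/
theorem exists_eigenbasis_of_pow_eq_one {V : Type*} [AddCommGroup V] [Module ℂ V]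
    [FiniteDimensional ℂ V] {T : Module.End ℂ V} {n : ℕ} (hn : n ≠ 0) (hT : T ^ n = 1) :
    ∃ (ι : Type) (_ : Fintype ι) (b : Module.Basis ι ℂ V) (μ : ι → ℂ),
      ∀ i, T (b i) = μ i • b i := by
  classical
  have hss : T.IsSemisimple := by
    refine Module.End.isSemisimple_of_squarefree_aeval_eq_zero
      (p := (Polynomial.X ^ n - 1 : Polynomial ℂ)) ?_ (by simp [hT])
    exact ((Polynomial.X_pow_sub_one_separable_iff).2 (by exact_mod_cast hn)).squarefree
  have hinternal : DirectSum.IsInternal (fun μ : ℂ => T.eigenspace μ) := by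
    rw [DirectSum.isInternal_submodule_iff_iSupIndep_and_iSup_eq_top]
    exact ⟨T.eigenspaces_iSupIndep, hss.iSup_eigenspace_eq_top⟩
  let b := hinternal.collectedBasis fun μ => Module.finBasis ℂ (T.eigenspace μ)
  have : Fintype (Σ μ : ℂ, Fin (Module.finrank ℂ (T.eigenspace μ))) :=
    FiniteDimensional.fintypeBasisIndex b
  refine ⟨_, inferInstance, b, fun i => i.1, fun i => ?_⟩
  exact Module.End.mem_eigenspace_iff.1 (hinternal.collectedBasis_mem _ i)

/-- The eigenvalues of a group element in a representation with character `χ` compute the values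
of `χ` on all powers of that element. -/
theorem IsIrrChar.exists_eigenvalues {G : Type} [Group G] [Finite G] {χ : G → ℂ}
    (hχ : IsIrrChar G χ) (g : G) :
    ∃ (ι : Type) (_ : Fintype ι) (μ : ι → ℂ), (∀ t, g ^ t = 1 → ∀ i, μ i ^ t = 1) ∧
      (∀ j, χ (g ^ j) = ∑ i, μ i ^ j) ∧ ((∀ i, μ i = 1) → ∀ x, χ (x * g) = χ x) := by
  classical
  obtain ⟨V, -, rfl⟩ := hχ
  obtain ⟨ι, hι, b, μ, hμ⟩ := exists_eigenbasis_of_pow_eq_one (T := V.ρ g) (n := Nat.card G)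
    Nat.card_pos.ne' (by rw [← map_pow, pow_card_eq_one', map_one])
  have hpow : ∀ j i, V.ρ (g ^ j) (b i) = μ i ^ j • b i := by
    intro j i
    induction j with
    | zero => simp
    | succ j ih =>
      rw [pow_succ', map_mul, Module.End.mul_apply, ih, map_smul, hμ, smul_smul, pow_succ]
  refine ⟨ι, hι, μ, fun t ht i => ?_, fun j => ?_, fun h x => ?_⟩
  · have := hpow t i
    rw [ht, map_one, Module.End.one_apply] at this
    have h2 : (1 - μ i ^ t) • b i = 0 := by rw [sub_smul, ← this, one_smul, sub_self]
    have := (smul_eq_zero.1 h2).resolve_right (b.ne_zero i)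
    exact (sub_eq_zero.1 this).symm
  · rw [FDRep.character, LinearMap.trace_eq_matrix_trace ℂ b, Matrix.trace]
    refine Finset.sum_congr rfl fun i _ => ?_
    rw [Matrix.diag_apply, LinearMap.toMatrix_apply, hpow]
    simp
  · have : V.ρ g = 1 := b.ext fun i => by simp [hμ, h]
    rw [FDRep.character, map_mul, this, mul_one]; rfl

namespace IsIrrChar

variable {G : Type} [Group G] {χ ψ : G → ℂ}

theorem conj_apply (hχ : IsIrrChar G χ) (g x : G) : χ (x * g * x⁻¹) = χ g := by
  obtain ⟨V, -, rfl⟩ := hχ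
  exact V.char_conj g x

theorem apply_eq_of_isConj (hχ : IsIrrChar G χ) {g h : G} (hgh : IsConj g h) : χ g = χ h := by
  obtain ⟨x, rfl⟩ := isConj_iff.1 hgh
  exact (hχ.conj_apply g x).symm

theorem exists_degree (hχ : IsIrrChar G χ) : ∃ d : ℕ, 0 < d ∧ χ 1 = d := by
  obtain ⟨V, hV, rfl⟩ := hχ
  refine ⟨_, Nat.pos_of_ne_zero fun h => ?_, V.char_one⟩
  have hs : Subsingleton V := Module.finrank_zero_iff.1 h
  apply id_nonzero V
  ext x
  exact Subsingleton.elim (α := V) _ _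

variable [Finite G]

theorem apply_inv (hχ : IsIrrChar G χ) (g : G) : χ g⁻¹ = starRingEnd ℂ (χ g) := by
  obtain ⟨ι, _, μ, h1, h2, -⟩ := hχ.exists_eigenvalues g
  have hn : 0 < Nat.card G := Nat.card_pos
  have hg : g⁻¹ = g ^ (Nat.card G - 1) := by
    rw [inv_eq_iff_mul_eq_one, ← pow_succ', Nat.sub_add_cancel hn, pow_card_eq_one']
  have h3 := h2 1
  rw [pow_one] at h3
  rw [hg, h2, h3, map_sum]
  refine Finset.sum_congr rfl fun i _ => ?_
  have hμ : μ i ^ Nat.card G = 1 := h1 _ pow_card_eq_one' i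
  have hnorm : ‖μ i‖ = 1 := Complex.norm_eq_one_of_pow_eq_one hμ hn.ne'
  have h0 : μ i ≠ 0 := by rintro h; simp [h] at hnorm
  rw [pow_one, ← Complex.inv_eq_conj hnorm]
  apply eq_inv_of_mul_eq_one_left
  rw [← pow_succ, Nat.sub_add_cancel hn, hμ]

theorem norm_apply_le (hχ : IsIrrChar G χ) (g : G) : ‖χ g‖ ≤ ‖χ 1‖ := by
  obtain ⟨ι, _, μ, h1, h2, -⟩ := hχ.exists_eigenvalues g
  have h3 := h2 1
  have h4 := h2 0
  simp only [pow_one, pow_zero] at h3 h4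
  rw [h3, h4]
  refine (norm_sum_le _ _).trans ?_
  simp [fun i => Complex.norm_eq_one_of_pow_eq_one (h1 _ pow_card_eq_one' i) Nat.card_pos.ne']

theorem apply_mul_of_apply_eq (hχ : IsIrrChar G χ) {g : G} (hg : χ g = χ 1) (x : G) :
    χ (x * g) = χ x := by
  obtain ⟨ι, _, μ, h1, h2, h5⟩ := hχ.exists_eigenvalues g
  refine h5 ?_ x
  have h3 := h2 1
  have h4 := h2 0
  simp only [pow_one, pow_zero] at h3 h4
  have hnorm : ∀ i, ‖μ i‖ = 1 := fun i =>
    Complex.norm_eq_one_of_pow_eq_one (h1 _ pow_card_eq_one' i) Nat.card_pos.ne'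
  have hre : ∀ i, (μ i).re ≤ 1 := fun i => (Complex.re_le_norm _).trans (hnorm i).le
  have hsum : ∑ i, (1 - (μ i).re) = 0 := by
    have := congrArg Complex.re (h3.symm.trans (hg.trans h4))
    rw [Complex.re_sum, Complex.re_sum] at this
    rw [Finset.sum_sub_distrib, this]
    simp
  intro i
  have hi := (Finset.sum_eq_zero_iff_of_nonneg fun i _ => sub_nonneg.2 (hre i)).1 hsum i
    (Finset.mem_univ i)
  have hre1 : (μ i).re = 1 := by linarith
  have hsq := Complex.sq_norm (μ i)
  rw [hnorm, Complex.normSq_apply, hre1] at hsq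
  apply Complex.ext
  · simpa using hre1
  · have : (μ i).im * (μ i).im = 0 := by linarith
    simpa using this

theorem exists_sum_pow_mul_eq (hχ : IsIrrChar G χ) {g : G} {t : ℕ} (hg : g ^ t = 1)
    {ζ : ℂ} (hζ : ζ ^ t = 1) :
    ∃ k : ℤ, ∑ i ∈ Finset.range t, χ (g ^ i) * ζ ^ i = t * k := by
  classical
  obtain ⟨ι, _, μ, h1, h2, -⟩ := hχ.exists_eigenvalues g
  refine ⟨∑ i : ι, if μ i * ζ = 1 then 1 else 0, ?_⟩
  simp_rw [h2, Finset.sum_mul, ← mul_pow]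
  rw [Finset.sum_comm, Int.cast_sum, Finset.mul_sum]
  refine Finset.sum_congr rfl fun i _ => ?_
  split_ifs with h
  · simp [h]
  · have h3 : (μ i * ζ) ^ t = 1 := by rw [mul_pow, h1 t hg, hζ, one_mul]
    rw [geom_sum_eq h, h3]
    simp

theorem exists_polynomial (hχ : IsIrrChar G χ) (g : G) {n : ℕ} (hg : g ^ n = 1) (hn : n ≠ 0)
    {ω : ℂ} (hω : IsPrimitiveRoot ω n) :
    ∃ f : Polynomial ℤ, ∀ j, χ (g ^ j) = Polynomial.aeval (ω ^ j) f := by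
  obtain ⟨ι, _, μ, h1, h2, -⟩ := hχ.exists_eigenvalues g
  have := NeZero.mk hn
  choose e he using fun i => hω.eq_pow_of_pow_eq_one (h1 n hg i)
  refine ⟨∑ i, Polynomial.X ^ e i, fun j => ?_⟩
  rw [h2, map_sum]
  refine Finset.sum_congr rfl fun i _ => ?_
  rw [← (he i).2, map_pow, Polynomial.aeval_X, ← pow_mul, ← pow_mul, mul_comm]

theorem card_dvd_degree (hχ : IsIrrChar G χ) {d : ℕ} (hd : χ 1 = d) (P : Subgroup G)
    (hP : ∀ x ∈ P, x ≠ 1 → χ x = 0) : Nat.card P ∣ d := by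
  classical
  have := Fintype.ofFinite G
  obtain ⟨V, -, rfl⟩ := hχ
  let W : FDRep ℂ P := FDRep.of (V.ρ.comp P.subtype)
  have hW : ∀ x : P, W.character x = V.character x := fun x => rfl
  have hne : (Nat.card P : ℂ) ≠ 0 := by exact_mod_cast Nat.card_pos.ne'
  have := invertibleOfNonzero hne
  have h := W.average_char_eq_finrank_invariants
  rw [Finset.sum_eq_single (1 : P) (fun x _ hx => by
    rw [hW]; exact hP x x.2 (by simpa using hx)) (by simp), hW, P.coe_one, hd,
    inv_mul_eq_iff_eq_mul₀ hne] at h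
  exact ⟨_, by exact_mod_cast h⟩

end IsIrrChar

theorem isIrrChar_one (G : Type) [Group G] [Finite G] : IsIrrChar G (fun _ => 1) := by
  classical
  have := Fintype.ofFinite G
  let V : FDRep ℂ G := FDRep.of (1 : G →* (ℂ →ₗ[ℂ] ℂ))
  have hV : V.character = fun _ => 1 := by
    funext g
    change LinearMap.trace ℂ ℂ 1 = 1
    simp
  refine ⟨V, ?_, hV⟩
  rw [FDRep.simple_iff_char_is_norm_one, hV]
  simp

theorem IsIrrChar.sum_mul_conj {G : Type} [Group G] [Fintype G] {χ ψ : G → ℂ}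
    (hχ : IsIrrChar G χ) (hψ : IsIrrChar G ψ) [Decidable (χ = ψ)] :
    ∑ g, χ g * starRingEnd ℂ (ψ g) = if χ = ψ then (Nat.card G : ℂ) else 0 := by
  classical
  simp_rw [← hψ.apply_inv]
  have hne : (Nat.card G : ℂ) ≠ 0 := by exact_mod_cast Nat.card_pos.ne'
  have := invertibleOfNonzero hne
  obtain ⟨V, hV, rfl⟩ := hχ
  split_ifs with h
  · subst h
    have h := FDRep.char_orthonormal V V
    rw [if_pos ⟨Iso.refl V⟩, inv_mul_eq_iff_eq_mul₀ hne, mul_one] at h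
    exact h
  · obtain ⟨W, hW, rfl⟩ := hψ
    have h' := FDRep.char_orthonormal V W
    rw [if_neg (fun ⟨i⟩ => h (FDRep.char_iso i)), inv_mul_eq_iff_eq_mul₀ hne, mul_zero] at h'
    exact h'

theorem linearIndependent_irrChar (G : Type) [Group G] [Finite G] :
    LinearIndependent ℂ (fun χ : {χ : G → ℂ // IsIrrChar G χ} => χ.1) := by
  classical
  have := Fintype.ofFinite G
  rw [linearIndependent_iff']
  intro s c hc χ hχ
  have h : ∑ g, (∑ ψ ∈ s, c ψ • ψ.1) g * starRingEnd ℂ (χ.1 g) = 0 := by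
    rw [hc]; simp
  simp_rw [Finset.sum_apply, Finset.sum_mul, Pi.smul_apply, smul_eq_mul, mul_assoc] at h
  rw [Finset.sum_comm] at h
  simp_rw [← Finset.mul_sum, fun ψ : {χ : G → ℂ // IsIrrChar G χ} => ψ.2.sum_mul_conj χ.2] at h
  rw [Finset.sum_eq_single χ (fun ψ _ hψ => by rw [if_neg (fun h => hψ (Subtype.ext h)), mul_zero])
    (fun h => absurd hχ h), if_pos rfl] at h
  exact (mul_eq_zero.1 h).resolve_right (by exact_mod_cast Nat.card_pos.ne')

instance finite_irrChar (G : Type) [Group G] [Finite G] : Finite {χ : G → ℂ // IsIrrChar G χ} :=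
  (linearIndependent_irrChar G).finite

open scoped MonoidAlgebra in
/-- A class function orthogonal to all irreducible characters vanishes. -/
theorem eq_zero_of_forall_sum_mul_irrChar {G : Type} [Group G] [Fintype G] {f : G → ℂ}
    (hf : ∀ g x, f (x * g * x⁻¹) = f g)
    (h : ∀ χ, IsIrrChar G χ → ∑ g, f g * χ g = 0) : f = 0 := by
  classical
  have hne : (Nat.card G : ℂ) ≠ 0 := by exact_mod_cast Nat.card_pos.ne'
  have := invertibleOfNonzero hne
  have := NeZero.mk hne
  let a : ℂ[G] := ∑ g, MonoidAlgebra.single g (f g)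
  have ha : ∀ b : ℂ[G], a * b = b * a := by
    intro b
    induction b using MonoidAlgebra.induction_on with
    | of x =>
      simp only [a, Finset.sum_mul, Finset.mul_sum, MonoidAlgebra.of_apply,
        MonoidAlgebra.single_mul_single, mul_one, one_mul]
      refine Fintype.sum_equiv (MulAut.conj x⁻¹).toEquiv _ _ fun g => ?_
      have := hf g x⁻¹
      rw [inv_inv, mul_assoc] at this
      simp [this, mul_assoc]
    | add b c hb hc => rw [mul_add, add_mul, hb, hc]
    | smul r b hb => rw [mul_smul_comm, smul_mul_assoc, hb]
  have hlift : ∀ S : Submodule ℂ[G] ℂ[G], ∀ (b : ℂ[G]) (s : S),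
      (Representation.ofModule' (k := ℂ) (G := G) S).asAlgebraHom b s = b • s := by
    intro S b s
    simp [Representation.asAlgebraHom, Representation.ofModule']
  have key : ∀ S : Submodule ℂ[G] ℂ[G], IsSimpleModule ℂ[G] S → ∀ s ∈ S, a * s = 0 := by
    intro S hS s hs
    have : Module.Finite ℂ S := inferInstance
    obtain ⟨c, hc⟩ := (IsSimpleModule.algebraMap_end_bijective_of_isAlgClosed (A := ℂ[G])
      (V := S) ℂ).2
      { toFun := fun s => a • s
        map_add' := smul_add a
        map_smul' := fun b s => by simp only [smul_smul, ha, RingHom.id_apply] }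
    have hc' : ∀ s : S, c • s = a • s := fun s => congrArg (fun φ => φ s) hc
    let ρ : Representation ℂ G S := Representation.ofModule' S
    let e : ρ.asModule ≃ₗ[ℂ[G]] S :=
      { ρ.asModuleEquiv with
        map_smul' := fun b x => by
          refine (ρ.asModuleEquiv_map_smul b x).trans ?_
          exact hlift S b _ }
    have hirr : ρ.IsIrreducible := by
      rw [Representation.irreducible_iff_isSimpleModule_asModule]
      exact IsSimpleModule.congr e
    have hsimple : Simple (FDRep.of ρ) := by
      rw [FDRep.simple_iff_char_is_norm_one]
      have h := Representation.char_orthonormal ρ ρ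
      rw [if_pos ⟨Representation.Equiv.refl ρ⟩, inv_mul_eq_iff_eq_mul₀ hne, mul_one] at h
      exact h
    have htr := h _ ⟨FDRep.of ρ, hsimple, rfl⟩
    have hop : ∑ g, f g • ρ g = algebraMap ℂ (Module.End ℂ S) c := by
      ext1 s
      rw [Module.algebraMap_end_apply, hc', ← hlift]
      simp [a, ρ, map_sum, Representation.asAlgebraHom_single, LinearMap.sum_apply]
    have htr' := congrArg (LinearMap.trace ℂ S) hop
    rw [map_sum, Algebra.algebraMap_eq_smul_one, map_smul, LinearMap.trace_one] at htr'
    simp_rw [map_smul, smul_eq_mul] at htr'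
    have h0 : c * (Module.finrank ℂ S : ℂ) = 0 := htr'.symm.trans htr
    have : Nontrivial S := IsSimpleModule.nontrivial ℂ[G] S
    have hc0 : c = 0 := (mul_eq_zero.1 h0).resolve_right
      (by exact_mod_cast (Module.finrank_pos (R := ℂ) (M := S)).ne')
    have := hc' ⟨s, hs⟩
    rw [hc0, zero_smul] at this
    exact (congrArg Subtype.val this).symm
  have hle : (⊤ : Submodule ℂ[G] ℂ[G]) ≤ LinearMap.ker (LinearMap.toSpanSingleton ℂ[G] ℂ[G] a) := by
    rw [← IsSemisimpleModule.sSup_simples_eq_top ℂ[G] ℂ[G]]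
    refine sSup_le fun S hS s hs => ?_
    rw [LinearMap.mem_ker, LinearMap.toSpanSingleton_apply, smul_eq_mul, ← ha]
    exact key S hS s hs
  have h1 : a = 0 := by
    simpa using hle (x := 1) trivial
  funext g
  have := congrArg (fun b : ℂ[G] => b.coeff g) h1
  simpa [a, Finsupp.single_apply] using this

theorem IsIrrChar.sum_isConj {G : Type} [Group G] [Fintype G] {χ : G → ℂ} (hχ : IsIrrChar G χ)
    (d : G) [DecidablePred (IsConj d)] :
    ∑ g, (if IsConj d g then 1 else 0) * starRingEnd ℂ (χ g) =
      Nat.card {x // IsConj d x} * starRingEnd ℂ (χ d) := by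
  rw [Nat.card_eq_fintype_card, Fintype.card_subtype, ← nsmul_eq_mul, ← Finset.sum_const,
    Finset.sum_filter]
  refine Finset.sum_congr rfl fun g _ => ?_
  split_ifs with h
  · rw [one_mul, hχ.apply_eq_of_isConj h]
  · rw [zero_mul]

/-- Column orthogonality of irreducible characters. -/
theorem sum_irrChar_mul_conj {G : Type} [Group G] [Finite G] [Fintype {χ : G → ℂ // IsIrrChar G χ}]
    (c d : G) [Decidable (IsConj d c)] :
    Nat.card {x // IsConj d x} *
      ∑ χ : {χ : G → ℂ // IsIrrChar G χ}, χ.1 c * starRingEnd ℂ (χ.1 d) =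
      if IsConj d c then (Nat.card G : ℂ) else 0 := by
  classical
  have := Fintype.ofFinite G
  have hne : (Nat.card G : ℂ) ≠ 0 := by exact_mod_cast Nat.card_pos.ne'
  let F : G → ℂ := fun x => Nat.card G * (if IsConj d x then 1 else 0) -
    Nat.card {x // IsConj d x} *
      ∑ χ : {χ : G → ℂ // IsIrrChar G χ}, χ.1 x * starRingEnd ℂ (χ.1 d)
  have horth : ∀ ψ : G → ℂ, IsIrrChar G ψ → ∑ g, F g * starRingEnd ℂ (ψ g) = 0 := by
    intro ψ hψ
    have h1 : ∀ g, F g * starRingEnd ℂ (ψ g) =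
        Nat.card G * ((if IsConj d g then 1 else 0) * starRingEnd ℂ (ψ g)) -
        Nat.card {x // IsConj d x} * ∑ χ : {χ : G → ℂ // IsIrrChar G χ},
          (χ.1 g * starRingEnd ℂ (ψ g)) * starRingEnd ℂ (χ.1 d) := by
      intro g
      simp only [F, sub_mul, mul_assoc, Finset.sum_mul]
      congr 2
      exact Finset.sum_congr rfl fun χ _ => by rw [mul_comm (starRingEnd ℂ (χ.1 d))]
    simp_rw [h1]
    rw [Finset.sum_sub_distrib, ← Finset.mul_sum, ← Finset.mul_sum, hψ.sum_isConj,
      Finset.sum_comm]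
    simp_rw [← Finset.sum_mul, fun χ : {χ : G → ℂ // IsIrrChar G χ} => χ.2.sum_mul_conj hψ]
    rw [Finset.sum_eq_single ⟨ψ, hψ⟩ (fun χ _ h => by
      rw [if_neg (fun h' => h (Subtype.ext h')), zero_mul]) (by simp), if_pos rfl]
    ring
  have hF : (fun x => starRingEnd ℂ (F x)) = 0 := by
    refine eq_zero_of_forall_sum_mul_irrChar (fun g x => ?_) fun χ hχ => ?_
    · have h1 : IsConj d (x * g * x⁻¹) ↔ IsConj d g := by
        have h2 : IsConj g (x * g * x⁻¹) := isConj_iff.2 ⟨x, rfl⟩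
        exact ⟨fun h => h.trans h2.symm, fun h => h.trans h2⟩
      simp only [F, h1, fun χ : {χ : G → ℂ // IsIrrChar G χ} => χ.2.conj_apply g x]
    · have := congrArg (starRingEnd ℂ) (horth χ hχ)
      simpa using this
  have h := congrArg (starRingEnd ℂ) (congrFun hF c)
  simp only [Pi.zero_apply, map_zero, Complex.conj_conj, F, sub_eq_zero] at h
  rw [← h]
  split_ifs <;> simp

theorem isConj_of_forall_irrChar_eq {G : Type} [Group G] [Finite G] {c d : G}
    (h : ∀ χ, IsIrrChar G χ → χ c = χ d) : IsConj c d := by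
  classical
  have := Fintype.ofFinite {χ : G → ℂ // IsIrrChar G χ}
  by_contra hcd
  have h1 := sum_irrChar_mul_conj (G := G) c d
  have h2 := sum_irrChar_mul_conj (G := G) d d
  rw [if_neg (fun h => hcd h.symm)] at h1
  simp_rw [fun χ : {χ : G → ℂ // IsIrrChar G χ} => h χ.1 χ.2] at h1
  rw [if_pos (IsConj.refl d), h1] at h2
  exact Nat.card_pos.ne' (by exact_mod_cast h2.symm)

theorem IsIrrChar.isIntegral {G : Type} [Group G] [Finite G] {χ : G → ℂ} (hχ : IsIrrChar G χ)
    (g : G) : IsIntegral ℤ (χ g) := by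
  have hn : Nat.card G ≠ 0 := Nat.card_pos.ne'
  have hω := Complex.isPrimitiveRoot_exp _ hn
  obtain ⟨f, hf⟩ := hχ.exists_polynomial g (pow_card_eq_one' (x := g)) hn hω
  have := hf 1
  rw [pow_one, pow_one] at this
  rw [this]
  exact adjoin_le_integralClosure (hω.isIntegral (Nat.pos_of_ne_zero hn))
    (Polynomial.aeval_mem_adjoin_singleton ℤ _)

theorem IsIrrChar.degree_ne_zero {G : Type} [Group G] {χ : G → ℂ} (hχ : IsIrrChar G χ) :
    χ 1 ≠ 0 := by
  obtain ⟨d, hd, h⟩ := hχ.exists_degree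
  rw [h]
  exact_mod_cast hd.ne'

theorem sum_eq_of_support_isConj {G : Type*} [Group G] [Fintype G] {F : G → ℂ} {c : G} (hc : c ≠ 1)
    (hconj : ∀ g, IsConj c g → F g = F c) (h0 : ∀ g, g ≠ 1 → ¬IsConj c g → F g = 0) :
    ∑ g, F g = F 1 + Nat.card {x // IsConj c x} * F c := by
  classical
  have h1 : ∀ g, F g = (if g = 1 then F 1 else 0) + if IsConj c g then F c else 0 := by
    intro g
    by_cases hg : g = 1
    · subst hg
      have : ¬IsConj c 1 := fun h => hc (isConj_one_right.1 h.symm)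
      rw [if_pos rfl, if_neg this, add_zero]
    · by_cases hcg : IsConj c g
      · rw [if_neg hg, if_pos hcg, zero_add, hconj g hcg]
      · rw [if_neg hg, if_neg hcg, zero_add, h0 g hg hcg]
  rw [Finset.sum_congr rfl fun g _ => h1 g, Finset.sum_add_distrib, Finset.sum_ite_eq',
    if_pos (Finset.mem_univ _), ← Finset.sum_filter, Finset.sum_const, nsmul_eq_mul,
    Nat.card_eq_fintype_card, Fintype.card_subtype]

section

variable {G : Type} [Group G] [Finite G]

/-- The common kernel of all irreducible characters different from `χ₀`. -/
def otherKernel (G : Type) [Group G] [Finite G] (χ₀ : G → ℂ) : Subgroup G where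
  carrier := {g | ∀ χ, IsIrrChar G χ → χ ≠ χ₀ → χ g = χ 1}
  one_mem' := fun _ _ _ => rfl
  mul_mem' := fun {a b} ha hb χ hχ hne =>
    (hχ.apply_mul_of_apply_eq (hb χ hχ hne) a).trans (ha χ hχ hne)
  inv_mem' := fun {a} ha χ hχ hne => by
    rw [hχ.apply_inv, ha χ hχ hne, ← hχ.apply_inv, inv_one]

theorem mem_otherKernel {χ₀ : G → ℂ} {g : G} :
    g ∈ otherKernel G χ₀ ↔ ∀ χ, IsIrrChar G χ → χ ≠ χ₀ → χ g = χ 1 := Iff.rfl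

instance otherKernel_normal (χ₀ : G → ℂ) : (otherKernel G χ₀).Normal :=
  ⟨fun g hg x χ hχ hne => (hχ.conj_apply g x).trans (hg χ hχ hne)⟩

variable {χ₀ : G → ℂ} {c : G}

theorem apply_one_mul_add_eq_zero (hχ₀ : IsIrrChar G χ₀) (hc : c ≠ 1)
    (hvan : ∀ g, g ≠ 1 → ¬IsConj c g → χ₀ g = 0) {χ : G → ℂ} (hχ : IsIrrChar G χ) (hne : χ ≠ χ₀) :
    χ 1 * starRingEnd ℂ (χ₀ 1) +
      Nat.card {x // IsConj c x} * (χ c * starRingEnd ℂ (χ₀ c)) = 0 := by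
  classical
  have := Fintype.ofFinite G
  have h := hχ.sum_mul_conj hχ₀
  rw [if_neg hne, sum_eq_of_support_isConj hc] at h
  · exact h
  · intro g hg
    rw [hχ.apply_eq_of_isConj hg, hχ₀.apply_eq_of_isConj hg]
  · intro g hg hcg
    rw [hvan g hg hcg, map_zero, mul_zero]

theorem exists_degree_eq_card_mul (hχ₀ : IsIrrChar G χ₀) (h1 : χ₀ ≠ fun _ => 1) (hc : c ≠ 1)
    (hvan : ∀ g, g ≠ 1 → ¬IsConj c g → χ₀ g = 0) :
    ∃ e : ℕ, 0 < e ∧ χ₀ 1 = (Nat.card {x // IsConj c x} * e : ℕ) ∧ χ₀ c = -e ∧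
      Nat.card G = Nat.card {x // IsConj c x} * (Nat.card {x // IsConj c x} + 1) * e ^ 2 := by
  classical
  have := Fintype.ofFinite G
  set k := Nat.card {x // IsConj c x} with hk
  have : Nonempty {x // IsConj c x} := ⟨c, IsConj.refl c⟩
  have hk0 : 0 < k := Nat.card_pos
  have hkC : (k : ℂ) ≠ 0 := by exact_mod_cast hk0.ne'
  obtain ⟨n, hn, hn1⟩ := hχ₀.exists_degree
  have h2 := apply_one_mul_add_eq_zero hχ₀ hc hvan (isIrrChar_one G) h1.symm
  rw [hn1, Complex.conj_natCast, one_mul, one_mul, ← hk] at h2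
  have h3 : χ₀ c = -(n / k : ℂ) := by
    have := congrArg (starRingEnd ℂ) h2
    simp only [map_add, map_mul, Complex.conj_natCast, Complex.conj_conj, map_zero] at this
    field_simp
    linear_combination this
  obtain ⟨e, he⟩ : ∃ e : ℤ, (e : ℂ) = n / k := by
    have h4 : IsIntegral ℤ ((n / k : ℚ) : ℂ) := by
      have := (hχ₀.isIntegral c).neg
      rw [h3, neg_neg] at this
      push_cast
      exact this
    have h5 : IsIntegral ℤ (n / k : ℚ) :=
      (isIntegral_algebraMap_iff (A := ℚ) (B := ℂ) (algebraMap ℚ ℂ).injective).1 (by simpa using h4)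
    obtain ⟨e, he⟩ := IsIntegrallyClosed.isIntegral_iff.1 h5
    refine ⟨e, ?_⟩
    have := congrArg (fun x : ℚ => (x : ℂ)) he
    simpa using this
  have h6 : (n : ℤ) = k * e := by
    rw [eq_div_iff hkC] at he
    have : (n : ℂ) = k * e := by rw [← he, mul_comm]
    exact_mod_cast this
  have he0 : 0 < e := by
    have : (0 : ℤ) < k * e := by rw [← h6]; exact_mod_cast hn
    exact pos_of_mul_pos_right this (by positivity)
  lift e to ℕ using he0.le
  have h7 : n = k * e := by exact_mod_cast h6
  rw [Int.cast_natCast] at he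
  rw [← he] at h3
  refine ⟨e, by exact_mod_cast he0, by rw [hn1, h7], h3, ?_⟩
  have h8 := hχ₀.sum_mul_conj hχ₀
  rw [if_pos rfl, sum_eq_of_support_isConj hc] at h8
  · rw [hn1, h3, h7, ← hk, map_neg, Complex.conj_natCast, Complex.conj_natCast] at h8
    have : (Nat.card G : ℂ) = (k * (k + 1) * e ^ 2 : ℕ) := by
      rw [← h8]; push_cast; ring
    exact_mod_cast this
  · intro g hg
    rw [hχ₀.apply_eq_of_isConj hg]
  · intro g hg hcg
    rw [hvan g hg hcg, zero_mul]

theorem mem_otherKernel_iff (hχ₀ : IsIrrChar G χ₀) (h1 : χ₀ ≠ fun _ => 1) (hc : c ≠ 1)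
    (hvan : ∀ g, g ≠ 1 → ¬IsConj c g → χ₀ g = 0) {g : G} :
    g ∈ otherKernel G χ₀ ↔ g = 1 ∨ IsConj c g := by
  classical
  refine ⟨fun hg => ?_, ?_⟩
  · by_contra hcon
    push Not at hcon
    have := Fintype.ofFinite {χ : G → ℂ // IsIrrChar G χ}
    have h2 := sum_irrChar_mul_conj g 1
    rw [if_neg (fun h => hcon.1 (isConj_one_right.1 h))] at h2
    have : Nonempty {x : G // IsConj 1 x} := ⟨1, IsConj.refl 1⟩
    have h3 := (mul_eq_zero.1 h2).resolve_left (by exact_mod_cast Nat.card_pos.ne')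
    have h4 : ∀ χ : {χ : G → ℂ // IsIrrChar G χ}, χ.1 g * starRingEnd ℂ (χ.1 1) =
        ((if χ.1 = χ₀ then 0 else ‖χ.1 1‖ ^ 2 : ℝ) : ℂ) := by
      intro χ
      split_ifs with h
      · rw [h, hvan g hcon.1 hcon.2]; simp
      · rw [hg χ.1 χ.2 h, Complex.mul_conj']; push_cast; rfl
    simp_rw [h4] at h3
    rw [← Complex.ofReal_sum, Complex.ofReal_eq_zero,
      Finset.sum_eq_zero_iff_of_nonneg (fun χ _ => by split_ifs <;> positivity)] at h3
    have h5 := h3 ⟨_, isIrrChar_one G⟩ (Finset.mem_univ _)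
    rw [if_neg h1.symm] at h5
    simp at h5
  · rintro (rfl | hg)
    · exact one_mem _
    · rw [mem_otherKernel]
      intro χ hχ hne
      have h2 := apply_one_mul_add_eq_zero hχ₀ hc hvan hχ hne
      have h3 := apply_one_mul_add_eq_zero hχ₀ hc hvan (isIrrChar_one G) h1.symm
      rw [← hχ.apply_eq_of_isConj hg]
      have h4 : (χ c - χ 1) * starRingEnd ℂ (χ₀ 1) = 0 := by
        linear_combination χ c * h3 - h2
      have h5 : starRingEnd ℂ (χ₀ 1) ≠ 0 := by simpa using hχ₀.degree_ne_zero
      exact sub_eq_zero.1 ((mul_eq_zero.1 h4).resolve_right h5)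

end

/-- The structure forced on a finite group by a nontrivial irreducible character `χ₀` vanishing
off the identity and one further conjugacy class: `N` is elementary abelian of order `p ^ r` and
`χ₀` has degree `(p ^ r - 1) * p ^ a`. -/
structure IsGagola {G : Type} [Group G] (χ₀ : G → ℂ) (N : Subgroup G) (p r a : ℕ) : Prop where
  normal : N.Normal
  prime : p.Prime
  r_ne_zero : r ≠ 0
  card_subgroup : Nat.card N = p ^ r
  pow_eq_one : ∀ u ∈ N, u ^ p = 1
  isConj : ∀ u ∈ N, ∀ v ∈ N, u ≠ 1 → v ≠ 1 → IsConj u v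
  isConj_mul : ∀ x, x ∉ N → ∀ u ∈ N, IsConj (x * u) x
  card : Nat.card G = (p ^ r - 1) * p ^ r * (p ^ a) ^ 2
  degree : χ₀ 1 = ((p ^ r - 1) * p ^ a : ℕ)
  vanish : ∀ x, x ∉ N → χ₀ x = 0
  apply_mul : ∀ χ, IsIrrChar G χ → χ ≠ χ₀ → ∀ u ∈ N, ∀ x, χ (x * u) = χ x
  pow_mem : ∀ x k, x ^ p ^ k = 1 → x ^ p ^ a ∈ N

theorem sum_range_pow_mul_eq {p s : ℕ} (hp : p ≠ 0) (f : ℕ → ℂ)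
    (hf : ∀ i, ¬p ^ s ∣ i → f i = 0) :
    ∑ i ∈ Finset.range (p ^ (s + 1)), f i = ∑ j ∈ Finset.range p, f (p ^ s * j) := by
  have hps : 0 < p ^ s := pow_pos (Nat.pos_of_ne_zero hp) s
  symm
  refine Finset.sum_of_injOn (fun j => p ^ s * j) ?_ ?_ ?_ fun _ _ => rfl
  · intro i _ j _ h
    exact Nat.eq_of_mul_eq_mul_left hps h
  · intro j hj
    rw [Finset.mem_coe, Finset.mem_range] at hj ⊢
    rw [pow_succ]
    exact Nat.mul_lt_mul_of_pos_left hj hps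
  · intro i hi hni
    refine hf i ?_
    rintro ⟨j, rfl⟩
    refine hni ⟨j, ?_, rfl⟩
    rw [Finset.mem_range, pow_succ] at hi
    exact Finset.mem_coe.2 (Finset.mem_range.2 (Nat.lt_of_mul_lt_mul_left hi))

theorem pow_mem_of_vanish {G : Type} [Group G] [Finite G] {χ₀ : G → ℂ} (hχ₀ : IsIrrChar G χ₀)
    {N : Subgroup G} [N.Normal] {p k a : ℕ} (hp : p.Prime) (hk : ¬p ∣ k)
    (hexp : ∀ u ∈ N, u ^ p = 1) (hdeg : χ₀ 1 = (k * p ^ a : ℕ))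
    (hN : ∀ u ∈ N, u ≠ 1 → χ₀ u = -(p ^ a : ℕ)) (hvan : ∀ x, x ∉ N → χ₀ x = 0)
    (x : G) (l : ℕ) (hx : x ^ p ^ l = 1) : x ^ p ^ a ∈ N := by
  have hp' : Fact p.Prime := ⟨hp⟩
  obtain ⟨s, -, hs⟩ := (Nat.dvd_prime_pow hp).1 (orderOf_dvd_of_pow_eq_one
    (x := (x : G ⧸ N)) (n := p ^ l) (by rw [← QuotientGroup.mk_pow, hx, QuotientGroup.mk_one]))
  have hmem : ∀ i : ℕ, x ^ i ∈ N ↔ p ^ s ∣ i := by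
    intro i
    rw [← QuotientGroup.eq_one_iff, QuotientGroup.mk_pow, ← hs, orderOf_dvd_iff_pow_eq_one]
  rw [hmem]
  refine pow_dvd_pow p ?_
  set u := x ^ p ^ s with hu
  have huN : u ∈ N := (hmem _).2 dvd_rfl
  have hup : u ^ p = 1 := hexp u huN
  have hxt : x ^ p ^ (s + 1) = 1 := by rw [pow_succ, pow_mul]; exact hup
  have ht0 : p ^ (s + 1) ≠ 0 := pow_ne_zero _ hp.ne_zero
  have hζ := Complex.isPrimitiveRoot_exp _ ht0
  set ζ := Complex.exp (2 * Real.pi * Complex.I / (p ^ (s + 1) : ℕ)) with hζdef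
  have hω : IsPrimitiveRoot (ζ ^ p ^ s) p := hζ.pow (Nat.pos_of_ne_zero ht0) (pow_succ p s)
  obtain ⟨k₁, hk₁⟩ := hχ₀.exists_sum_pow_mul_eq hxt hζ.pow_eq_one
  obtain ⟨k₂, hk₂⟩ := hχ₀.exists_sum_pow_mul_eq (ζ := 1) hxt (one_pow _)
  have hdiff : ∑ i ∈ Finset.range (p ^ (s + 1)), χ₀ (x ^ i) * (1 ^ i - ζ ^ i) =
      (p ^ (s + 1) : ℕ) * ((k₂ - k₁ : ℤ) : ℂ) := by
    simp_rw [mul_sub]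
    rw [Finset.sum_sub_distrib, hk₁, hk₂]
    push_cast
    ring
  rw [sum_range_pow_mul_eq hp.ne_zero _ (fun i hi => by
    rw [hvan _ (fun h => hi ((hmem i).1 h)), zero_mul])] at hdiff
  have hsum : ∑ j ∈ Finset.range p, (1 - (ζ ^ p ^ s) ^ j) = p := by
    rw [Finset.sum_sub_distrib, hω.geom_sum_eq_zero hp.one_lt]
    simp
  have hval : ∃ d : ℤ, ¬(p : ℤ) ∣ d ∧
      ∀ j ∈ Finset.range p, χ₀ (x ^ (p ^ s * j)) * (1 ^ (p ^ s * j) - ζ ^ (p ^ s * j)) =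
        (d * p ^ a : ℤ) * (1 - (ζ ^ p ^ s) ^ j) := by
    by_cases hu1 : u = 1
    · refine ⟨k, by exact_mod_cast hk, fun j _ => ?_⟩
      rw [pow_mul, ← hu, hu1, one_pow, one_pow, hdeg, pow_mul]
      push_cast
      rfl
    · refine ⟨-1, fun h => hp.one_lt.ne' ?_, fun j hj => ?_⟩
      · have := Int.isUnit_iff_natAbs_eq.1 (isUnit_of_dvd_unit h (by simp))
        simpa using this
      · rw [pow_mul x, ← hu, one_pow, pow_mul ζ]
        rcases Nat.eq_zero_or_pos j with rfl | hj0
        · simp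
        · rw [hN _ (pow_mem huN j) (fun h => ?_)]
          · push_cast
            ring
          · rw [← orderOf_dvd_iff_pow_eq_one, orderOf_eq_prime hup hu1] at h
            exact absurd (Nat.le_of_dvd hj0 h) (not_le.2 (Finset.mem_range.1 hj))
  obtain ⟨d, hd, hval⟩ := hval
  rw [Finset.sum_congr rfl hval, ← Finset.mul_sum, hsum] at hdiff
  have h1 : d * p ^ a * p = p ^ (s + 1) * (k₂ - k₁) := by exact_mod_cast hdiff
  have hp0 : (p : ℤ) ≠ 0 := by exact_mod_cast hp.ne_zero
  have h2 : (p : ℤ) ^ s ∣ d * p ^ a := by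
    refine ⟨k₂ - k₁, mul_right_cancel₀ hp0 ?_⟩
    rw [h1]; ring
  have h3 : (p : ℤ) ^ s ∣ p ^ a :=
    ((((Nat.prime_iff_prime_int.1 hp).coprime_iff_not_dvd.2 hd)).pow_left).dvd_of_dvd_mul_left h2
  have h4 : p ^ s ∣ p ^ a := by exact_mod_cast h3
  exact (Nat.pow_dvd_pow_iff_le_right hp.one_lt).1 h4

theorem exists_pow_eq_one_prime_of_isConj {G : Type*} [Group G] [Finite G] {N : Subgroup G}
    (hN : N ≠ ⊥) (hconj : ∀ u ∈ N, ∀ v ∈ N, u ≠ 1 → v ≠ 1 → IsConj u v) :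
    ∃ p r : ℕ, p.Prime ∧ r ≠ 0 ∧ Nat.card N = p ^ r ∧ ∀ u ∈ N, u ^ p = 1 := by
  obtain ⟨⟨c, hcN⟩, hc'⟩ := Subgroup.ne_bot_iff_exists_ne_one.1 hN
  have hc : c ≠ 1 := fun h => hc' (Subtype.ext h)
  have hord : orderOf c ≠ 1 := fun h => hc (orderOf_eq_one_iff.1 h)
  set p := (orderOf c).minFac with hpdef
  have hp : p.Prime := Nat.minFac_prime hord
  have hp' : Fact p.Prime := ⟨hp⟩
  set v := c ^ (orderOf c / p) with hv
  have hvord : orderOf v = p :=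
    orderOf_pow_orderOf_div (orderOf_pos _).ne' (Nat.minFac_dvd _)
  have hvN : v ∈ N := pow_mem hcN _
  have hv1 : v ≠ 1 := fun h => hp.one_lt.ne' (by rw [← hvord, h, orderOf_one])
  have hexp : ∀ u ∈ N, u ^ p = 1 := by
    intro u hu
    by_cases hu1 : u = 1
    · rw [hu1, one_pow]
    · obtain ⟨g, hg⟩ := isConj_iff.1 (hconj v hvN u hu hv1 hu1)
      rw [← hg, conj_pow, ← hvord, pow_orderOf_eq_one, mul_one, mul_inv_cancel]
  have hPN : IsPGroup p N := isPGroup_iff_pow_pow_eq_one.2 fun u =>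
    ⟨1, Subtype.ext (by simpa using hexp u u.2)⟩
  obtain ⟨r, hr⟩ := IsPGroup.iff_card.1 hPN
  refine ⟨p, r, hp, ?_, hr, hexp⟩
  rintro rfl
  exact hN (Subgroup.card_eq_one.1 (by rw [hr, pow_zero]))

theorem exists_isGagola {G : Type} [Group G] [Finite G] {χ₀ : G → ℂ} (hχ₀ : IsIrrChar G χ₀)
    (h1 : χ₀ ≠ fun _ => 1) {c : G} (hc : c ≠ 1)
    (hvan : ∀ g, g ≠ 1 → ¬IsConj c g → χ₀ g = 0) :
    ∃ N p r a, IsGagola χ₀ N p r a := by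
  classical
  set N := otherKernel G χ₀ with hNdef
  have hmem : ∀ g, g ∈ N ↔ g = 1 ∨ IsConj c g := fun g => mem_otherKernel_iff hχ₀ h1 hc hvan
  set k := Nat.card {x // IsConj c x} with hk
  obtain ⟨e, he, hdeg, hχc, hcard⟩ := exists_degree_eq_card_mul hχ₀ h1 hc hvan
  rw [← hk] at hdeg hcard
  have hcN : c ∈ N := (hmem c).2 (Or.inr (IsConj.refl c))
  have hconj : ∀ u ∈ N, ∀ v ∈ N, u ≠ 1 → v ≠ 1 → IsConj u v := fun u hu v hv hu1 hv1 =>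
    (((hmem u).1 hu).resolve_left hu1).symm.trans (((hmem v).1 hv).resolve_left hv1)
  obtain ⟨p, r, hp, hr0, hr, hexp⟩ := exists_pow_eq_one_prime_of_isConj
    (fun h => hc (by rw [h] at hcN; exact hcN)) hconj
  have hp' : Fact p.Prime := ⟨hp⟩
  have hkN : Nat.card N = k + 1 := by
    have := Fintype.ofFinite G
    have h2 : (Finset.univ.filter fun g => g ∈ N) =
        insert 1 (Finset.univ.filter fun g => IsConj c g) := by
      ext g
      simp only [Finset.mem_filter_univ, Finset.mem_insert, hmem]
    have h3 := congrArg Finset.card h2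
    rw [Finset.card_insert_of_notMem (by
      rw [Finset.mem_filter_univ]
      exact fun h => hc (isConj_one_right.1 h.symm)), ← Fintype.card_subtype,
      ← Fintype.card_subtype, ← Nat.card_eq_fintype_card, ← Nat.card_eq_fintype_card] at h3
    exact h3
  have hkp : k + 1 = p ^ r := by rw [← hkN, hr]
  have hk' : k = p ^ r - 1 := by omega
  have hk0 : k ≠ 0 := fun h => by
    have := Nat.one_lt_pow hr0 hp.one_lt
    omega
  have hpk : ¬p ∣ k := fun h => hp.one_lt.ne' (Nat.dvd_one.1 ((Nat.dvd_add_right h).1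
    (hkp ▸ dvd_pow_self p hr0)))
  have hvanN : ∀ x, x ∉ N → χ₀ x = 0 := fun x hx => by
    rw [hmem] at hx
    push Not at hx
    exact hvan x hx.1 hx.2
  have happ : ∀ χ, IsIrrChar G χ → χ ≠ χ₀ → ∀ u ∈ N, ∀ x, χ (x * u) = χ x :=
    fun χ hχ hne u hu x => hχ.apply_mul_of_apply_eq (hu χ hχ hne) x
  obtain ⟨a, ha⟩ : ∃ a, e = p ^ a := by
    refine ⟨_, Nat.eq_prime_pow_of_unique_prime_dvd he.ne' fun {l} hl hle => ?_⟩
    by_contra hlp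
    have hl' : Fact l.Prime := ⟨hl⟩
    obtain ⟨P⟩ : Nonempty (Sylow l G) := inferInstance
    have hdvd := hχ₀.card_dvd_degree hdeg (P : Subgroup G) (fun x hx hx1 => by
      refine hvanN x fun hxN => hx1 ?_
      obtain ⟨j, hj⟩ := IsPGroup.iff_orderOf.1 P.isPGroup' ⟨x, hx⟩
      rw [Subgroup.orderOf_mk] at hj
      have h2 : orderOf x ∣ p := orderOf_dvd_of_pow_eq_one (hexp x hxN)
      have h3 : (orderOf x).Coprime p := by
        rw [hj]
        exact Nat.Coprime.pow_left _ ((Nat.coprime_primes hl hp).2 hlp)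
      exact orderOf_eq_one_iff.1 (Nat.eq_one_of_dvd_coprimes h3 dvd_rfl h2))
    rw [show Nat.card (P : Subgroup G) = l ^ (Nat.card G).factorization l from
      P.card_eq_multiplicity, hl.pow_dvd_iff_le_factorization (mul_ne_zero hk0 he.ne'), hcard,
      Nat.factorization_mul (by positivity) (by positivity), Nat.factorization_mul hk0 (by omega),
      Nat.factorization_mul hk0 he.ne', Nat.factorization_pow] at hdvd
    simp only [Finsupp.add_apply, Finsupp.smul_apply, smul_eq_mul] at hdvd
    have := hl.factorization_pos_of_dvd he.ne' hle
    omega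
  subst ha
  refine ⟨N, p, r, a, inferInstance, hp, hr0, hr, hexp, hconj, ?_, ?_, ?_, hvanN, happ, ?_⟩
  · intro x hx u hu
    refine isConj_of_forall_irrChar_eq fun χ hχ => ?_
    by_cases hne : χ = χ₀
    · subst hne
      rw [hvanN x hx, hvanN _ fun h => hx ((Subgroup.mul_mem_cancel_right N hu).1 h)]
    · exact happ χ hχ hne u hu x
  · rw [hcard, hkp, hk']
  · rw [hdeg, hk']
  · refine pow_mem_of_vanish hχ₀ hp hpk hexp hdeg (fun u hu hu1 => ?_) hvanN
    rw [← hχ₀.apply_eq_of_isConj (((hmem u).1 hu).resolve_left hu1), hχc]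

section FreeAction

variable {H : Type*} [Group H] {p : ℕ} [hp : Fact p.Prime]

open scoped Classical in
/-- An abelian normal subgroup of exponent `l` on which every element of order `p ≠ l` acts
without nontrivial fixed points: commuting elements of order `p` generate a cyclic group. -/
theorem mem_zpowers_of_commute_of_pow_eq_one {N : Subgroup H} [N.Normal] {l : ℕ}
    (hl : l.Prime) (hpl : p ≠ l)
    (hexp : ∀ u ∈ N, u ^ l = 1) (hnt : ∃ u ∈ N, u ≠ 1)
    (hcomm : ∀ u ∈ N, ∀ v ∈ N, u * v = v * u)
    (hfree : ∀ x : H, x ^ p = 1 → x ≠ 1 → ∀ u ∈ N, x * u = u * x → u = 1)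
    {z h : H} (hz : z ^ p = 1) (hz1 : z ≠ 1) (hh : h ^ p = 1) (hzh : Commute h z) :
    h ∈ Subgroup.zpowers z := by
  by_contra hmem
  let _ : CommGroup N := { (inferInstance : Group N) with
    mul_comm := fun u v => Subtype.ext (hcomm u u.2 v v.2) }
  let ρ : H →* AddMonoid.End (Additive N) :=
    { toFun := fun g => MonoidHom.toAdditive (MulAut.conjNormal g : MulAut N).toMonoidHom
      map_one' := by rw [map_one]; rfl
      map_mul' := fun a b => by rw [map_mul]; rfl }
  have hnorm : ∀ y : H, y ^ p = 1 → y ≠ 1 → ∑ i ∈ Finset.range p, ρ (y ^ i) = 0 := by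
    intro y hy hy1
    have hfix : ρ y * ∑ i ∈ Finset.range p, ρ (y ^ i) = ∑ i ∈ Finset.range p, ρ (y ^ i) := by
      rw [Finset.mul_sum]
      have h1 := Finset.sum_range_succ (fun i => ρ (y ^ i)) p
      have h2 := Finset.sum_range_succ' (fun i => ρ (y ^ i)) p
      rw [h1, hy, pow_zero] at h2
      simp_rw [← map_mul, ← pow_succ']
      exact (add_right_cancel h2).symm
    ext1 u
    set w := (∑ i ∈ Finset.range p, ρ (y ^ i)) u with hw
    have h3 : ρ y w = w := by
      rw [hw]
      exact DFunLike.congr_fun hfix u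
    have h4 : y * (w.toMul : H) * y⁻¹ = w.toMul :=
      congrArg (fun t : Additive N => (t.toMul : H)) h3
    have h5 := hfree y hy hy1 w.toMul w.toMul.2 (mul_inv_eq_iff_eq_mul.1 h4)
    exact congrArg Additive.ofMul (Subtype.ext h5 : w.toMul = 1)
  have h0 : ∑ j ∈ Finset.range p, ∑ i ∈ Finset.range p, ρ ((h * z ^ j) ^ i) = 0 := by
    refine Finset.sum_eq_zero fun j _ => hnorm _ ?_ ?_
    · rw [(hzh.pow_right j).mul_pow, hh, ← pow_mul, mul_comm, pow_mul, hz, one_pow, one_mul]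
    · intro h1
      rw [mul_eq_one_iff_eq_inv] at h1
      exact hmem (h1 ▸ inv_mem (pow_mem (Subgroup.mem_zpowers z) j))
  have h1 : ∀ i ∈ Finset.range p, ∑ j ∈ Finset.range p, ρ ((h * z ^ j) ^ i) =
      if i = 0 then (p : AddMonoid.End (Additive N)) else 0 := by
    intro i hi
    split_ifs with hi0
    · simp [hi0]
    · have h2 : ∀ j, ρ ((h * z ^ j) ^ i) = ρ (h ^ i) * ρ ((z ^ i) ^ j) := by
        intro j
        rw [(hzh.pow_right j).mul_pow, map_mul, ← pow_mul, ← pow_mul, mul_comm i]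
      simp_rw [h2]
      rw [← Finset.mul_sum, hnorm, mul_zero]
      · rw [← pow_mul, mul_comm, pow_mul, hz, one_pow]
      · intro h3
        rw [← orderOf_dvd_iff_pow_eq_one, orderOf_eq_prime hz hz1] at h3
        exact absurd (Nat.le_of_dvd (Nat.pos_of_ne_zero hi0) h3) (by simpa using hi)
  rw [Finset.sum_comm, Finset.sum_congr rfl h1, Finset.sum_ite_eq', if_pos (by simpa using hp.out.pos)]
    at h0
  obtain ⟨u, hu, hu1⟩ := hnt
  have h2 : p • Additive.ofMul (⟨u, hu⟩ : N) = 0 := by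
    have := DFunLike.congr_fun h0 (Additive.ofMul (⟨u, hu⟩ : N))
    simpa using this
  have h3 : u ^ p = 1 := congrArg (fun t : Additive N => (t.toMul : H)) h2
  refine hu1 ?_
  have h4 := pow_gcd_eq_one.2 ⟨h3, hexp u hu⟩
  rwa [(Nat.coprime_primes hp.out hl).2 hpl, pow_one] at h4

theorem mem_zpowers_of_commute
    (hstar : ∀ z h : H, z ^ p = 1 → z ≠ 1 → h ^ p = 1 → Commute h z → h ∈ Subgroup.zpowers z)
    {s : ℕ} (hs : 1 ≤ s) (hmax : ∀ (t : H) (k : ℕ), t ^ p ^ k = 1 → t ^ p ^ s = 1)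
    {y : H} (hy : orderOf y = p ^ s) (k : ℕ) {t : H} (ht : t ^ p ^ k = 1) (hty : Commute t y) :
    t ∈ Subgroup.zpowers y := by
  induction k generalizing t with
  | zero =>
    rw [pow_zero, pow_one] at ht
    rw [ht]
    exact one_mem _
  | succ k ih =>
    obtain ⟨r, rfl⟩ : ∃ r, s = r + 1 := ⟨s - 1, by omega⟩
    obtain ⟨c, hc⟩ := ih (t := t ^ p) (by rw [← pow_mul, ← pow_succ', ht]) (hty.pow_left p)
    simp only at hc
    have hpc : (p : ℤ) ∣ c := by
      have h1 : y ^ (c * (p ^ r : ℕ)) = 1 := by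
        rw [zpow_mul, hc, zpow_natCast, ← pow_mul, ← pow_succ']
        exact hmax t _ ht
      rw [← orderOf_dvd_iff_zpow_eq_one, hy, pow_succ'] at h1
      push_cast at h1
      exact Int.dvd_of_mul_dvd_mul_right
        (by exact_mod_cast (pow_pos hp.out.pos r).ne') h1
    obtain ⟨d, rfl⟩ := hpc
    have hz : (y ^ p ^ r) ^ p = 1 := by
      rw [← pow_mul, ← pow_succ, ← hy, pow_orderOf_eq_one]
    have hz1 : y ^ p ^ r ≠ 1 := by
      rw [Ne, ← orderOf_dvd_iff_pow_eq_one, hy]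
      exact fun h => absurd (Nat.le_of_dvd (pow_pos hp.out.pos r) h)
        (not_le.2 (Nat.pow_lt_pow_right hp.out.one_lt (Nat.lt_succ_self r)))
    have hh : (t * y ^ (-d)) ^ p = 1 := by
      rw [(hty.zpow_right _).mul_pow, ← hc, ← zpow_natCast (y ^ (-d)), ← zpow_mul, ← zpow_add]
      simp [mul_comm]
    have hcomm : Commute (t * y ^ (-d)) (y ^ p ^ r) :=
      (hty.mul_left ((Commute.refl y).zpow_left _)).pow_right _
    have h1 := hstar _ _ hz hz1 hh hcomm
    have h2 : t * y ^ (-d) ∈ Subgroup.zpowers y :=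
      (Subgroup.zpowers_le.2 (pow_mem (Subgroup.mem_zpowers y) _)) h1
    simpa using mul_mem h2 (zpow_mem (Subgroup.mem_zpowers y) d)

end FreeAction

/-- A nontrivial normal subgroup of a finite `p`-group contains a central element of order `p`. -/
theorem IsPGroup.exists_mem_center_pow_eq_one {Q : Type*} [Group Q] [Finite Q] {p : ℕ}
    [hp : Fact p.Prime] (hQ : IsPGroup p Q) (M : Subgroup Q) [M.Normal] (hM : M ≠ ⊥) :
    ∃ t ∈ M, t ≠ 1 ∧ t ^ p = 1 ∧ ∀ g, g * t = t * g := by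
  let _ : MulAction Q M := MulAction.compHom M (MulAut.conjNormal : Q →* MulAut M)
  have hsmul : ∀ (g : Q) (m : M), ((g • m : M) : Q) = g * m * g⁻¹ := fun g m => rfl
  have hdvd : p ∣ Nat.card M := by
    refine (hQ.to_subgroup M).card_eq_or_dvd.resolve_left fun h => hM ?_
    exact Subgroup.card_eq_one.1 h
  obtain ⟨b, hb, hb1⟩ := hQ.exists_fixed_point_of_prime_dvd_card_of_fixed_point M hdvd
    (a := 1) (fun g => Subtype.ext (by simp [hsmul]))
  have hbc : ∀ g : Q, g * b = b * g := fun g => by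
    rw [← mul_inv_eq_iff_eq_mul, ← hsmul, hb g]
  have hb1' : (b : Q) ≠ 1 := fun h => hb1 (Subtype.ext h.symm)
  obtain ⟨k, hk⟩ := IsPGroup.iff_orderOf.1 hQ (b : Q)
  obtain ⟨r, rfl⟩ : ∃ r, k = r + 1 := by
    refine ⟨k - 1, (Nat.succ_pred_eq_of_ne_zero fun h => hb1' ?_).symm⟩
    rw [h, pow_zero, orderOf_eq_one_iff] at hk
    exact hk
  refine ⟨(b : Q) ^ p ^ r, pow_mem b.2 _, ?_, ?_, fun g => ?_⟩
  · rw [Ne, ← orderOf_dvd_iff_pow_eq_one, hk]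
    exact fun h => absurd (Nat.le_of_dvd (pow_pos hp.out.pos r) h)
      (not_le.2 (Nat.pow_lt_pow_right hp.out.one_lt (Nat.lt_succ_self r)))
  · rw [← pow_mul, ← pow_succ, ← hk, pow_orderOf_eq_one]
  · exact (Commute.pow_right (hbc g) _)

theorem card_lt_orderOf_sq {Q : Type*} [Group Q] [Finite Q] [Nontrivial Q] {p : ℕ}
    [hp : Fact p.Prime] (hQ : IsPGroup p Q)
    (hstar : ∀ z h : Q, z ^ p = 1 → z ≠ 1 → h ^ p = 1 → Commute h z → h ∈ Subgroup.zpowers z) :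
    ∃ y : Q, Nat.card Q < orderOf y ^ 2 := by
  obtain ⟨y, hyn, hymax⟩ : ∃ y : Q, (Subgroup.zpowers y).Normal ∧
      ∀ t : Q, (Subgroup.zpowers t).Normal → orderOf t ≤ orderOf y := by
    obtain ⟨y, hy, h⟩ := Set.exists_max_image {y : Q | (Subgroup.zpowers y).Normal} orderOf
      (Set.toFinite _) ⟨1, by
        rw [Set.mem_ofPred_eq, Subgroup.zpowers_one_eq_bot]; infer_instance⟩
    exact ⟨y, hy, h⟩
  have hy1 : y ≠ 1 := by
    rintro rfl
    obtain ⟨t, -, ht1, -, htc⟩ := hQ.exists_mem_center_pow_eq_one ⊤ top_ne_bot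
    have h1 := hymax t ⟨by
      rintro _ ⟨k, rfl⟩ g
      simp only
      rw [Commute.zpow_right (htc g) k, mul_inv_cancel_right]
      exact ⟨k, rfl⟩⟩
    rw [orderOf_one] at h1
    exact ht1 (orderOf_eq_one_iff.1 (le_antisymm h1 (orderOf_pos t)))
  set B := Subgroup.zpowers y with hB
  have hyB : y ∈ B := Subgroup.mem_zpowers y
  have hC : ∀ g : Q, Commute g y → g ∈ B := by
    by_contra hcon
    push Not at hcon
    obtain ⟨g₀, hg₀, hg₀B⟩ := hcon
    let C : Subgroup Q := Subgroup.centralizer (B : Set Q)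
    have hCmem : ∀ g, g ∈ C ↔ Commute g y := by
      intro g
      rw [Subgroup.mem_centralizer_iff]
      refine ⟨fun h => (h y hyB).symm, ?_⟩
      rintro h _ ⟨k, rfl⟩
      exact (h.zpow_right k).symm
    have : C.Normal := inferInstance
    have hBC : B ≤ C := Subgroup.zpowers_le.2 ((hCmem y).2 (Commute.refl y))
    have hMn : (C.map (QuotientGroup.mk' B)).Normal :=
      Subgroup.Normal.map this _ (QuotientGroup.mk'_surjective B)
    obtain ⟨t', ht'M, ht'1, ht'p, ht'c⟩ := (hQ.to_quotient B).exists_mem_center_pow_eq_one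
      (C.map (QuotientGroup.mk' B)) (fun h => by
        rw [Subgroup.map_eq_bot_iff, QuotientGroup.ker_mk'] at h
        exact hg₀B (h ((hCmem g₀).2 hg₀)))
    obtain ⟨t, htC, rfl⟩ := ht'M
    rw [QuotientGroup.mk'_apply] at ht'1 ht'p ht'c
    have htB : t ∉ B := fun h => ht'1 ((QuotientGroup.eq_one_iff t).2 h)
    have hty : Commute t y := (hCmem t).1 htC
    have htp : t ^ p ∈ B := (QuotientGroup.eq_one_iff _).1 ht'p
    obtain ⟨c, hc⟩ := htp
    simp only at hc
    by_cases hpc : (p : ℤ) ∣ c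
    · obtain ⟨d, rfl⟩ := hpc
      obtain ⟨z, hzB, hz1, hzp, -⟩ := (hQ.to_subgroup B).exists_mem_center_pow_eq_one ⊤ (by
        intro h
        have : (⟨y, hyB⟩ : B) ∈ (⊤ : Subgroup B) := trivial
        rw [h, Subgroup.mem_bot] at this
        exact hy1 (congrArg Subtype.val this))
      have hzt : Commute (t * y ^ (-d)) (z : Q) := by
        obtain ⟨k, hk⟩ := z.2
        simp only at hk
        rw [← hk]
        exact (hty.mul_left ((Commute.refl y).zpow_left _)).zpow_right _
      have h1 := hstar (z : Q) (t * y ^ (-d)) (by exact_mod_cast congrArg Subtype.val hzp)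
        (fun h => hz1 (Subtype.ext h)) (by
          rw [(hty.zpow_right _).mul_pow, ← hc, ← zpow_natCast (y ^ (-d)), ← zpow_mul, ← zpow_add]
          simp [mul_comm]) hzt
      have h2 : t * y ^ (-d) ∈ B := (Subgroup.zpowers_le.2 z.2) h1
      exact htB (by simpa using mul_mem h2 (zpow_mem hyB d))
    · have hyt : y ∈ Subgroup.zpowers t := by
        obtain ⟨k, hk⟩ := IsPGroup.iff_orderOf.1 hQ y
        have hco : IsCoprime c (orderOf y : ℤ) := by
          rw [hk]
          push_cast
          exact ((Nat.prime_iff_prime_int.1 hp.out).coprime_iff_not_dvd.2 hpc).symm.pow_right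
        obtain ⟨u, v, huv⟩ := hco
        refine ⟨p * u, ?_⟩
        simp only
        rw [zpow_mul, zpow_natCast, ← hc, ← zpow_mul]
        nth_rw 2 [← zpow_one y]
        rw [← huv, zpow_add, mul_comm u, mul_comm v, zpow_mul y (orderOf y : ℤ)]
        simp
      have hBt : B ≤ Subgroup.zpowers t := Subgroup.zpowers_le.2 hyt
      have htn : (Subgroup.zpowers t).Normal := by
        refine ⟨?_⟩
        rintro _ ⟨k, rfl⟩ g
        simp only
        rw [← conj_zpow]
        refine zpow_mem ?_ k
        have h1 : t⁻¹ * (g * t * g⁻¹) ∈ B := by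
          rw [← QuotientGroup.eq]
          have := ht'c g
          rw [QuotientGroup.mk_mul, QuotientGroup.mk_mul, QuotientGroup.mk_inv, this,
            mul_inv_cancel_right]
        simpa using mul_mem (Subgroup.mem_zpowers t) (hBt h1)
      have h1 := hymax t htn
      rw [← Nat.card_zpowers, ← Nat.card_zpowers] at h1
      have h2 := Subgroup.eq_of_le_of_card_ge hBt h1
      exact htB (h2 ▸ Subgroup.mem_zpowers t)
  refine ⟨y, ?_⟩
  have hlt : Nat.card (Q ⧸ B) < Nat.card B := by
    let F : Q ⧸ B → B := fun c => ⟨c.out * y * c.out⁻¹, hyn.conj_mem y hyB _⟩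
    have hF : Function.Injective F := by
      intro c d hcd
      have h1 : c.out * y * c.out⁻¹ = d.out * y * d.out⁻¹ := congrArg Subtype.val hcd
      have h2 : c.out⁻¹ * d.out ∈ B := by
        refine hC _ ?_
        have h3 := congrArg (fun x => c.out⁻¹ * x * d.out) h1
        simp only [mul_assoc, inv_mul_cancel_left, inv_mul_cancel, mul_one] at h3
        rw [Commute, SemiconjBy, mul_assoc, h3]
      rw [← QuotientGroup.eq] at h2
      simpa using h2
    refine lt_of_le_of_ne (Nat.card_le_card_of_injective F hF) fun h => ?_
    obtain ⟨c, hc⟩ := (hF.bijective_of_nat_card_le h.ge).2 1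
    have h1 : c.out * y * c.out⁻¹ = 1 := congrArg Subtype.val hc
    exact hy1 (conj_eq_one_iff.1 h1)
  rw [Subgroup.card_eq_card_quotient_mul_card_subgroup B, sq, ← Nat.card_zpowers]
  exact Nat.mul_lt_mul_of_pos_right hlt Nat.card_pos

theorem zpow_mul_pow_of_conj_eq {H : Type*} [Group H] {g y z : H} (hgy : g * y * g⁻¹ = y * z)
    (hzy : Commute z y) (hgz : Commute g z) (j : ℤ) (n : ℕ) :
    (y ^ j * g) ^ n = y ^ (j * n) * z ^ (j * (n.choose 2 : ℕ)) * g ^ n := by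
  have h1 : ∀ j : ℤ, g * y ^ j = y ^ j * z ^ j * g := by
    intro j
    rw [← hzy.symm.mul_zpow, ← hgy, conj_zpow, inv_mul_cancel_right]
  have h2 : ∀ n : ℕ, g ^ n * y ^ j = y ^ j * z ^ (j * n) * g ^ n := by
    intro n
    induction n with
    | zero => simp
    | succ n ih =>
      rw [pow_succ', mul_assoc, ih, ← mul_assoc, ← mul_assoc, h1,
        mul_assoc (y ^ j * z ^ j) g, (hgz.zpow_right _).eq, ← mul_assoc, mul_assoc (y ^ j),
        ← zpow_add, mul_assoc, ← pow_succ']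
      congr 3
      push_cast
      ring
  induction n with
  | zero => simp
  | succ n ih =>
    calc (y ^ j * g) ^ (n + 1)
        = y ^ (j * n) * z ^ (j * (n.choose 2 : ℕ)) * (g ^ n * y ^ j) * g := by
          rw [pow_succ, ih]; simp only [mul_assoc]
      _ = y ^ (j * n) * (z ^ (j * (n.choose 2 : ℕ)) * y ^ j) * z ^ (j * n) * (g ^ n * g) := by
          rw [h2]; simp only [mul_assoc]
      _ = (y ^ (j * n) * y ^ j) * (z ^ (j * (n.choose 2 : ℕ)) * z ^ (j * n)) * g ^ (n + 1) := by
          rw [((hzy.zpow_left _).zpow_right _).eq, pow_succ]; simp only [mul_assoc]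
      _ = _ := by
          rw [← zpow_add, ← zpow_add, Nat.choose_succ_succ' n 1, Nat.choose_one_right]
          congr 3
          · push_cast; ring
          · push_cast; ring

theorem exists_dvd_exponent {p s : ℕ} (hp : p.Prime) (hs : 2 ≤ s) (hps : ¬(p = 2 ∧ s = 2))
    {m : ℕ} (hm : ¬p ∣ m) (d : ℤ) :
    ∃ j : ℤ, (p ^ s : ℤ) ∣ j * p + p ^ (s - 1) * m * (j * (p.choose 2 : ℕ)) + p * d := by
  obtain ⟨r, rfl⟩ : ∃ r, s = r + 2 := ⟨s - 2, by omega⟩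
  rcases hp.eq_two_or_odd' with rfl | hodd
  · obtain ⟨k, rfl⟩ : ∃ k, r = k + 1 := ⟨r - 1, by omega⟩
    have hm' : Odd (m : ℤ) := by
      rw [Int.odd_coe_nat]; exact Nat.not_even_iff_odd.1 fun h => hm h.two_dvd
    obtain ⟨u, hu⟩ := hm'
    rcases Int.even_or_odd d with ⟨v, hv⟩ | ⟨v, hv⟩
    · refine ⟨-d, -(m * v), ?_⟩
      simp only [hv, Nat.choose_self]
      push_cast
      ring_nf
    · refine ⟨-d + 2 ^ (k + 1), 2 ^ (k + 1) * u + 2 ^ k - u - v * m, ?_⟩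
      have : (k + 1 + 2 - 1) = k + 2 := by omega
      simp only [hv, Nat.choose_self, hu, this]
      push_cast
      ring
  · refine ⟨-d, ?_⟩
    obtain ⟨u, hu⟩ := hodd
    have h2 : p.choose 2 = p * u := by
      rw [Nat.choose_two_right, hu]
      simp only [Nat.add_sub_cancel]
      rw [show (2 * u + 1) * (2 * u) = 2 * ((2 * u + 1) * u) by ring]
      simp
    refine ⟨- m * d * u, ?_⟩
    rw [h2]
    have : r + 2 - 1 = r + 1 := by omega
    rw [this]
    push_cast
    ring

theorem pow_conj_eq_mul_pow {H : Type*} [Group H] {g y z : H} (hg : g * y * g⁻¹ = y * z)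
    (hgz : Commute g z) (n : ℕ) : g ^ n * y * (g ^ n)⁻¹ = y * z ^ n := by
  induction n with
  | zero => simp
  | succ n ih =>
    have h1 : g ^ (n + 1) * y * (g ^ (n + 1))⁻¹ = g * (g ^ n * y * (g ^ n)⁻¹) * g⁻¹ := by
      rw [pow_succ']; group
    rw [h1, ih, ← conj_mul, hg, (hgz.pow_right n).eq, mul_inv_cancel_right, pow_succ', mul_assoc]

theorem exists_maximal_orderOf_eq_prime_pow {H : Type*} [Group H] [Finite H] {p a : ℕ}
    [hp : Fact p.Prime] (ha : 1 ≤ a) (hcard : (Nat.card H).factorization p = 2 * a)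
    (hstar : ∀ z h : H, z ^ p = 1 → z ≠ 1 → h ^ p = 1 → Commute h z → h ∈ Subgroup.zpowers z) :
    ∃ (s : ℕ) (y : H), a + 1 ≤ s ∧ orderOf y = p ^ s ∧
      ∀ (t : H) (k : ℕ), t ^ p ^ k = 1 → t ^ p ^ s = 1 := by
  obtain ⟨P⟩ : Nonempty (Sylow p H) := inferInstance
  have hP : Nat.card P = p ^ (2 * a) := by rw [P.card_eq_multiplicity, hcard]
  have : Nontrivial P := by
    rw [← Finite.one_lt_card_iff_nontrivial, hP]
    exact Nat.one_lt_pow (by omega) hp.out.one_lt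
  obtain ⟨y₀, hy₀⟩ := card_lt_orderOf_sq P.isPGroup' (fun z h hz hz1 hh hc => by
    have := hstar (z : H) (h : H) (by exact_mod_cast congrArg Subtype.val hz)
      (fun h => hz1 (Subtype.ext h)) (by exact_mod_cast congrArg Subtype.val hh)
      (congrArg Subtype.val hc)
    obtain ⟨k, hk⟩ := this
    exact ⟨k, Subtype.ext (by simpa using hk)⟩)
  obtain ⟨y, ⟨s, hs⟩, hmax⟩ := Set.exists_max_image {y : H | ∃ k, orderOf y = p ^ k} orderOf
    (Set.toFinite _) ⟨1, 0, by simp⟩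
  have hlt : ∀ {i j : ℕ}, p ^ i ≤ p ^ j → i ≤ j := fun h =>
    (Nat.pow_le_pow_iff_right hp.out.one_lt).1 h
  refine ⟨s, y, ?_, hs, fun t k ht => ?_⟩
  · have h1 := hmax (y₀ : H) (by
      obtain ⟨k, hk⟩ := IsPGroup.iff_orderOf.1 P.isPGroup' y₀
      exact ⟨k, by rw [Subgroup.orderOf_coe, hk]⟩)
    rw [Subgroup.orderOf_coe, hs] at h1
    rw [hP] at hy₀
    have h2 := hy₀.trans_le (Nat.pow_le_pow_left h1 2)
    rw [← pow_mul, Nat.pow_lt_pow_iff_right hp.out.one_lt] at h2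
    omega
  · obtain ⟨j, -, hj⟩ := (Nat.dvd_prime_pow hp.out).1 (orderOf_dvd_of_pow_eq_one ht)
    have h1 := hmax t ⟨j, hj⟩
    rw [hj, hs] at h1
    rw [← orderOf_dvd_iff_pow_eq_one, hj]
    exact pow_dvd_pow p (hlt h1)

theorem false_of_conj_eq_mul_pow {H : Type*} [Group H] [Finite H] {p a : ℕ}
    [hp : Fact p.Prime] (ha : 1 ≤ a) (hcard : (Nat.card H).factorization p = 2 * a)
    (hstar : ∀ z h : H, z ^ p = 1 → z ≠ 1 → h ^ p = 1 → Commute h z → h ∈ Subgroup.zpowers z)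
    (htwist : ∀ (s : ℕ) (y : H), a + 1 ≤ s → orderOf y = p ^ s →
      ∃ (g : H) (m : ℕ), ¬p ∣ m ∧ g * y * g⁻¹ = y * y ^ (p ^ (s - 1) * m)) : False := by
  obtain ⟨s, y, hs, hy, hmax⟩ := exists_maximal_orderOf_eq_prime_pow ha hcard hstar
  obtain ⟨g₀, m₀, hm₀, hg₀⟩ := htwist s y hs hy
  have hps : p ^ s = p ^ (s - 1) * p := by rw [← pow_succ, Nat.sub_add_cancel (by omega)]
  have hyp : y ^ (p ^ s) = 1 := by rw [← hy, pow_orderOf_eq_one]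
  have hfix : ∀ g : H, ∀ m : ℕ, g * y * g⁻¹ = y * y ^ (p ^ (s - 1) * m) →
      Commute g (y ^ (p ^ (s - 1) * m)) := by
    intro g m hg
    rw [Commute, SemiconjBy, ← mul_inv_eq_iff_eq_mul, ← conj_pow, hg,
      ((Commute.refl y).pow_right _).mul_pow, mul_eq_left, ← pow_mul]
    rw [show p ^ (s - 1) * m * (p ^ (s - 1) * m) = p ^ s * (p ^ (s - 2) * m * m) by
      obtain ⟨r, rfl⟩ : ∃ r, s = r + 2 := ⟨s - 2, by omega⟩
      simp only [Nat.add_sub_cancel, show r + 2 - 1 = r + 1 by omega]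
      ring]
    rw [pow_mul, hyp, one_pow]
  obtain ⟨g, m, hm, hg, ⟨k, hk⟩⟩ : ∃ (g : H) (m : ℕ), ¬p ∣ m ∧
      g * y * g⁻¹ = y * y ^ (p ^ (s - 1) * m) ∧ ∃ k, g ^ p ^ k = 1 := by
    have hr0 := (orderOf_pos g₀).ne'
    refine ⟨g₀ ^ ordCompl[p] (orderOf g₀), m₀ * ordCompl[p] (orderOf g₀), ?_, ?_,
      (orderOf g₀).factorization p, ?_⟩
    · rw [hp.out.dvd_mul]
      exact not_or.2 ⟨hm₀, Nat.not_dvd_ordCompl hp.out hr0⟩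
    · rw [pow_conj_eq_mul_pow hg₀ (hfix g₀ m₀ hg₀), ← pow_mul, mul_assoc]
    · rw [← pow_mul, mul_comm, Nat.ordProj_mul_ordCompl_eq_self, pow_orderOf_eq_one]
  set z := y ^ (p ^ (s - 1) * m) with hz
  have hgz : Commute g z := hfix g m hg
  have hzy : Commute z y := (Commute.refl y).pow_left _
  have hzp : z ^ p = 1 := by
    rw [hz, ← pow_mul, mul_assoc, mul_comm m, ← mul_assoc, ← hps, pow_mul, hyp, one_pow]
  have hz1 : z ≠ 1 := by
    rw [hz, Ne, ← orderOf_dvd_iff_pow_eq_one, hy, hps]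
    exact fun h => hm (Nat.dvd_of_mul_dvd_mul_left (pow_pos hp.out.pos _) h)
  have hgy : g ∉ Subgroup.zpowers y := by
    rintro ⟨i, rfl⟩
    refine hz1 ?_
    rw [((Commute.refl y).zpow_left i).eq, mul_inv_cancel_right] at hg
    exact (mul_eq_left.1 hg.symm)
  by_cases hcase : p = 2 ∧ s = 2
  · obtain ⟨hp2, hs2⟩ := hcase
    let S : Sylow p H := Sylow.ofCard (Subgroup.zpowers y) (by
      rw [Nat.card_zpowers, hy, hcard]; congr 1; omega)
    have hgP : IsPGroup p (Subgroup.zpowers g) :=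
      IsPGroup.of_card_dvd_pow (n := k) (by
        rw [Nat.card_zpowers]; exact orderOf_dvd_of_pow_eq_one hk)
    have h1 := hgP.inf_normalizer_sylow S
    have h2 : g ∈ Subgroup.zpowers g ⊓ Subgroup.normalizer S := by
      refine ⟨Subgroup.mem_zpowers g, ?_⟩
      change g ∈ Subgroup.normalizer (Subgroup.zpowers y : Set H)
      rw [Subgroup.mem_normalizer_iff_map_conj_eq, MonoidHom.map_zpowers]
      refine Subgroup.eq_of_le_of_card_ge (Subgroup.zpowers_le.2 ?_) ?_
      · change g * y * g⁻¹ ∈ _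
        rw [hg]
        exact mul_mem (Subgroup.mem_zpowers y) (pow_mem (Subgroup.mem_zpowers y) _)
      · rw [Nat.card_zpowers, Nat.card_zpowers]
        exact (orderOf_injective (MulAut.conj g).toMonoidHom (MulAut.conj g).injective y).ge
    rw [h1] at h2
    exact hgy h2.2
  · have hgpy : Commute (g ^ p) y := by
      have h1 := pow_conj_eq_mul_pow hg hgz p
      rwa [hzp, mul_one, mul_inv_eq_iff_eq_mul] at h1
    obtain ⟨c, hc⟩ := mem_zpowers_of_commute hstar (by omega) hmax hy k
      (t := g ^ p) (by rw [← pow_mul, mul_comm, pow_mul, hk, one_pow]) hgpy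
    simp only at hc
    have hpc : (p : ℤ) ∣ c := by
      have h1 : g * y ^ c * g⁻¹ = y ^ c := by
        rw [hc, ← pow_succ', pow_succ, mul_inv_cancel_right]
      rw [← conj_zpow, hg, hzy.symm.mul_zpow, mul_eq_left, ← orderOf_dvd_iff_zpow_eq_one,
        orderOf_eq_prime hzp hz1] at h1
      exact h1
    obtain ⟨d, rfl⟩ := hpc
    obtain ⟨j, hj⟩ := exists_dvd_exponent hp.out (by omega : 2 ≤ s) hcase hm d
    have hh : (y ^ j * g) ^ p = 1 := by
      rw [zpow_mul_pow_of_conj_eq hg hzy hgz, hz, ← zpow_natCast y (p ^ (s - 1) * m), ← zpow_mul,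
        ← hc, ← zpow_add, ← zpow_add, ← orderOf_dvd_iff_zpow_eq_one, hy]
      push_cast
      exact hj
    have h1 := hstar z (y ^ j * g) hzp hz1 hh ((hzy.symm.zpow_left j).mul_left hgz)
    have h2 : y ^ j * g ∈ Subgroup.zpowers y :=
      Subgroup.zpowers_le.2 (pow_mem (Subgroup.mem_zpowers y) _) h1
    exact hgy (by simpa using mul_mem (zpow_mem (Subgroup.mem_zpowers y) (-j)) h2)

section

variable {G H : Type} [Group G] [Group H]

/-- The character tables of `G` and `H` agree, along `Φ` and `σ`, away from the rows of `χ₀` and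
`ψ₀`, and `σ` matches the classes of the identities. -/
structure RowMatch (χ₀ : G → ℂ) (ψ₀ : H → ℂ)
    (Φ : {χ : G → ℂ // IsIrrChar G χ ∧ χ ≠ χ₀} ≃ {ψ : H → ℂ // IsIrrChar H ψ ∧ ψ ≠ ψ₀})
    (σ : ConjClasses G ≃ ConjClasses H) : Prop where
  left : IsIrrChar G χ₀
  right : IsIrrChar H ψ₀
  apply_eq : ∀ χ g h, σ (ConjClasses.mk g) = ConjClasses.mk h → χ.1 g = (Φ χ).1 h
  map_one : σ (ConjClasses.mk 1) = ConjClasses.mk 1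

theorem IsIrrChar.classVal_mk [Finite G] {χ : G → ℂ} (hχ : IsIrrChar G χ) (g : G) :
    classVal χ (ConjClasses.mk g) = χ g :=
  hχ.apply_eq_of_isConj (ConjClasses.mk_eq_mk_iff_isConj.1 (Quotient.out_eq (ConjClasses.mk g)))

theorem sum_irrChar_eq_add_sum_ne {χ₀ : G → ℂ} (hχ₀ : IsIrrChar G χ₀)
    [Fintype {χ // IsIrrChar G χ}] [Fintype {χ : G → ℂ // IsIrrChar G χ ∧ χ ≠ χ₀}]
    (f : (G → ℂ) → ℂ) :
    ∑ χ : {χ // IsIrrChar G χ}, f χ.1 =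
      f χ₀ + ∑ χ : {χ : G → ℂ // IsIrrChar G χ ∧ χ ≠ χ₀}, f χ.1 := by
  classical
  rw [Fintype.sum_eq_add_sum_subtype_ne _ (⟨χ₀, hχ₀⟩ : {χ // IsIrrChar G χ})]
  congr 1
  exact Fintype.sum_equiv
    { toFun := fun χ => ⟨χ.1.1, χ.1.2, fun h => χ.2 (Subtype.ext h)⟩
      invFun := fun χ => ⟨⟨χ.1, χ.2.1⟩, fun h => χ.2.2 (congrArg Subtype.val h)⟩ } _ _
    fun _ => rfl

instance finite_irrChar_ne [Finite G] (χ₀ : G → ℂ) :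
    Finite {χ : G → ℂ // IsIrrChar G χ ∧ χ ≠ χ₀} :=
  Finite.of_injective (β := {χ // IsIrrChar G χ}) (fun χ => ⟨χ.1, χ.2.1⟩)
    fun _ _ h => Subtype.ext (Subtype.mk.inj h)

theorem IsIrrChar.sum_eq_zero [Finite G] [Fintype G] {χ : G → ℂ} (hχ : IsIrrChar G χ)
    (h1 : χ ≠ fun _ => 1) : ∑ g, χ g = 0 := by
  classical
  have h := hχ.sum_mul_conj (isIrrChar_one G)
  rw [if_neg h1] at h
  simpa using h

namespace RowMatch

variable {χ₀ : G → ℂ} {ψ₀ : H → ℂ}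
  {Φ : {χ : G → ℂ // IsIrrChar G χ ∧ χ ≠ χ₀} ≃ {ψ : H → ℂ // IsIrrChar H ψ ∧ ψ ≠ ψ₀}}
  {σ : ConjClasses G ≃ ConjClasses H}

theorem symm (hm : RowMatch χ₀ ψ₀ Φ σ) : RowMatch ψ₀ χ₀ Φ.symm σ.symm where
  left := hm.right
  right := hm.left
  apply_eq ψ h g hgh := by
    rw [hm.apply_eq (Φ.symm ψ) g h (by rw [← hgh, σ.apply_symm_apply]), Φ.apply_symm_apply]
  map_one := by rw [← hm.map_one, σ.symm_apply_apply]

theorem exists_mk_eq (σ : ConjClasses G ≃ ConjClasses H) (g : G) :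
    ∃ h, σ (ConjClasses.mk g) = ConjClasses.mk h :=
  ⟨_, (Quotient.out_eq (σ (ConjClasses.mk g))).symm⟩

theorem isConj_map_iff {c d : G} {c' d' : H} (hc : σ (ConjClasses.mk c) = ConjClasses.mk c')
    (hd : σ (ConjClasses.mk d) = ConjClasses.mk d') : IsConj d' c' ↔ IsConj d c := by
  rw [← ConjClasses.mk_eq_mk_iff_isConj, ← ConjClasses.mk_eq_mk_iff_isConj, ← hc, ← hd,
    σ.apply_eq_iff_eq]

theorem ne_one_iff (hm : RowMatch χ₀ ψ₀ Φ σ) {c : G} {c' : H}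
    (hc : σ (ConjClasses.mk c) = ConjClasses.mk c') : c' ≠ 1 ↔ c ≠ 1 := by
  rw [ne_eq, ne_eq, ← isConj_one_right, isConj_map_iff hc hm.map_one, isConj_one_right]

variable [Finite G] [Finite H]

theorem mul_conj_eq (hm : RowMatch χ₀ ψ₀ Φ σ) {c d : G} {c' d' : H}
    (hc : σ (ConjClasses.mk c) = ConjClasses.mk c')
    (hd : σ (ConjClasses.mk d) = ConjClasses.mk d') (hcd : ¬IsConj d c) :
    χ₀ c * starRingEnd ℂ (χ₀ d) = ψ₀ c' * starRingEnd ℂ (ψ₀ d') := by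
  classical
  have := Fintype.ofFinite {χ // IsIrrChar G χ}
  have := Fintype.ofFinite {χ // IsIrrChar H χ}
  have := Fintype.ofFinite {χ : G → ℂ // IsIrrChar G χ ∧ χ ≠ χ₀}
  have := Fintype.ofFinite {ψ : H → ℂ // IsIrrChar H ψ ∧ ψ ≠ ψ₀}
  have h1 := sum_irrChar_mul_conj c d
  have h2 := sum_irrChar_mul_conj c' d'
  have hG : Nat.card {x // IsConj d x} ≠ 0 :=
    (Nat.card_pos_iff.2 ⟨⟨⟨d, IsConj.refl d⟩⟩, inferInstance⟩).ne'
  have hH : Nat.card {x // IsConj d' x} ≠ 0 :=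
    (Nat.card_pos_iff.2 ⟨⟨⟨d', IsConj.refl d'⟩⟩, inferInstance⟩).ne'
  rw [if_neg hcd, mul_eq_zero, Nat.cast_eq_zero, or_iff_right hG,
    sum_irrChar_eq_add_sum_ne hm.left fun χ => χ c * starRingEnd ℂ (χ d)] at h1
  rw [if_neg fun h => hcd ((isConj_map_iff hc hd).1 h), mul_eq_zero, Nat.cast_eq_zero,
    or_iff_right hH,
    sum_irrChar_eq_add_sum_ne hm.right fun χ => χ c' * starRingEnd ℂ (χ d')] at h2
  rw [← Fintype.sum_equiv Φ (fun χ => χ.1 c * starRingEnd ℂ (χ.1 d)) _ fun χ => by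
    rw [hm.apply_eq χ c c' hc, hm.apply_eq χ d d' hd]] at h2
  exact add_right_cancel (h1.trans h2.symm)

theorem card_sub_eq (hm : RowMatch χ₀ ψ₀ Φ σ) :
    (Nat.card G : ℂ) - χ₀ 1 * χ₀ 1 = Nat.card H - ψ₀ 1 * ψ₀ 1 := by
  classical
  have := Fintype.ofFinite {χ // IsIrrChar G χ}
  have := Fintype.ofFinite {χ // IsIrrChar H χ}
  have := Fintype.ofFinite {χ : G → ℂ // IsIrrChar G χ ∧ χ ≠ χ₀}
  have := Fintype.ofFinite {ψ : H → ℂ // IsIrrChar H ψ ∧ ψ ≠ ψ₀}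
  have h1 := sum_irrChar_mul_conj (1 : G) 1
  have h2 := sum_irrChar_mul_conj (1 : H) 1
  rw [if_pos (IsConj.refl _),
    sum_irrChar_eq_add_sum_ne hm.left fun χ => χ 1 * starRingEnd ℂ (χ 1)] at h1
  rw [if_pos (IsConj.refl _),
    sum_irrChar_eq_add_sum_ne hm.right fun χ => χ 1 * starRingEnd ℂ (χ 1),
    ← Fintype.sum_equiv Φ (fun χ => χ.1 1 * starRingEnd ℂ (χ.1 1)) _ fun χ => by
      rw [hm.apply_eq χ 1 1 hm.map_one]] at h2
  have hsub : ∀ (K : Type) [Group K], Nat.card {x : K // IsConj 1 x} = 1 := fun K _ =>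
    Nat.card_eq_one_iff_unique.2 ⟨⟨fun x y => Subtype.ext
      ((isConj_one_right.1 x.2).trans (isConj_one_right.1 y.2).symm)⟩, ⟨1, IsConj.refl 1⟩⟩
  rw [hsub, Nat.cast_one, one_mul] at h1 h2
  rw [← hm.left.apply_inv, inv_one] at h1
  rw [← hm.right.apply_inv, inv_one] at h2
  rw [← h1, ← h2]
  ring

theorem apply_mul_degree (hm : RowMatch χ₀ ψ₀ Φ σ) {c : G} {c' : H}
    (hc : σ (ConjClasses.mk c) = ConjClasses.mk c') (hc1 : c ≠ 1) :
    χ₀ c * χ₀ 1 = ψ₀ c' * ψ₀ 1 := by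
  have h := hm.mul_conj_eq hc hm.map_one fun h => hc1 (isConj_one_right.1 h)
  rwa [← hm.left.apply_inv, ← hm.right.apply_inv, inv_one, inv_one] at h

theorem apply_left_eq (hm : RowMatch χ₀ ψ₀ Φ σ) (hdeg : χ₀ 1 = ψ₀ 1) {c : G} {c' : H}
    (hc : σ (ConjClasses.mk c) = ConjClasses.mk c') : χ₀ c = ψ₀ c' := by
  by_cases hc1 : c = 1
  · have hc' : c' = 1 := by
      by_contra h
      exact (hm.ne_one_iff hc).1 h hc1
    rw [hc1, hc', hdeg]
  · have h := hm.apply_mul_degree hc hc1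
    rw [hdeg] at h
    exact mul_right_cancel₀ hm.right.degree_ne_zero h

theorem apply_eq_zero_of_not_isConj (hm : RowMatch χ₀ ψ₀ Φ σ) (hdeg : χ₀ 1 ≠ ψ₀ 1) {c d : G}
    (hc1 : c ≠ 1) (hd1 : d ≠ 1) (hcd : ¬IsConj c d) (hc : χ₀ c ≠ 0) : χ₀ d = 0 := by
  by_contra hd
  obtain ⟨c', hc'⟩ := exists_mk_eq σ c
  obtain ⟨d', hd'⟩ := exists_mk_eq σ d
  have h1 := hm.apply_mul_degree hc' hc1
  have h2 := hm.apply_mul_degree hd' hd1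
  have h3 := hm.mul_conj_eq hd' hc' hcd
  obtain ⟨n, hn0, hn⟩ := hm.left.exists_degree
  obtain ⟨m, hm0, hmm⟩ := hm.right.exists_degree
  rw [hn, hmm] at h1 h2 hdeg
  have h1' := congrArg (starRingEnd ℂ) h1
  simp only [map_mul, map_natCast] at h1'
  have hne : χ₀ d * starRingEnd ℂ (χ₀ c) ≠ 0 :=
    mul_ne_zero hd ((map_ne_zero _).2 hc)
  have h4 : χ₀ d * starRingEnd ℂ (χ₀ c) * (n * n) = χ₀ d * starRingEnd ℂ (χ₀ c) * (m * m) := by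
    calc _ = (χ₀ d * n) * (starRingEnd ℂ (χ₀ c) * n) := by ring
      _ = (ψ₀ d' * starRingEnd ℂ (ψ₀ c')) * (m * m) := by rw [h2, h1']; ring
      _ = _ := by rw [h3]
  have h5 : n * n = m * m := by exact_mod_cast mul_left_cancel₀ hne h4
  exact hdeg (by rw [Nat.mul_self_inj.1 h5])

theorem left_ne_one (hm : RowMatch χ₀ ψ₀ Φ σ) (hdeg : χ₀ 1 ≠ ψ₀ 1) : χ₀ ≠ fun _ => 1 := by
  rintro rfl
  have := Fintype.ofFinite H
  have hψ : ψ₀ ≠ fun _ => 1 := by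
    rintro rfl
    exact hdeg rfl
  obtain ⟨m, hm0, hmm⟩ := hm.right.exists_degree
  have hpos : ∀ h, 0 < (ψ₀ h).re := by
    intro h
    by_cases h1 : h = 1
    · rw [h1, hmm, Complex.natCast_re]
      exact_mod_cast hm0
    · obtain ⟨g, hg⟩ := exists_mk_eq σ.symm h
      have h2 := hm.symm.apply_mul_degree hg h1
      rw [hmm, one_mul] at h2
      have h3 := congrArg Complex.re h2
      simp only [Complex.mul_re, Complex.natCast_re, Complex.natCast_im, mul_zero, sub_zero,
        Complex.one_re] at h3
      by_contra h4
      have h5 := mul_nonpos_of_nonpos_of_nonneg (not_lt.1 h4) (Nat.cast_nonneg m)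
      linarith
  have h := congrArg Complex.re (hm.right.sum_eq_zero hψ)
  rw [Complex.re_sum, Complex.zero_re] at h
  exact (Finset.sum_pos (fun h _ => hpos h) Finset.univ_nonempty).ne' h

theorem exists_isGagola (hm : RowMatch χ₀ ψ₀ Φ σ) (hdeg : χ₀ 1 ≠ ψ₀ 1) :
    ∃ N p r a, IsGagola χ₀ N p r a := by
  have := Fintype.ofFinite G
  have h1 := hm.left_ne_one hdeg
  obtain ⟨c, hc1, hc⟩ : ∃ c, c ≠ 1 ∧ χ₀ c ≠ 0 := by
    by_contra! h
    have h2 := hm.left.sum_eq_zero h1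
    rw [Fintype.sum_eq_single 1 h] at h2
    exact hm.left.degree_ne_zero h2
  exact _root_.exists_isGagola hm.left h1 hc1 fun g hg hcg =>
    hm.apply_eq_zero_of_not_isConj hdeg hc1 hg hcg hc

end RowMatch

end

theorem IsPrimitiveRoot.aeval_pow_eq_of_coprime {ω : ℂ} {n j : ℕ} (hω : IsPrimitiveRoot ω n)
    (hn : 0 < n) (hj : j.Coprime n) {f g : Polynomial ℤ}
    (h : Polynomial.aeval ω f = Polynomial.aeval ω g) :
    Polynomial.aeval (ω ^ j) f = Polynomial.aeval (ω ^ j) g := by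
  have hdvd : minpoly ℤ ω ∣ f - g :=
    minpoly.isIntegrallyClosed_dvd (hω.isIntegral hn) (by rw [map_sub, h, sub_self])
  rw [hω.minpoly_eq_pow_coprime hj] at hdvd
  obtain ⟨q, hq⟩ := hdvd
  have h2 := congrArg (Polynomial.aeval (ω ^ j)) hq
  rwa [map_mul, minpoly.aeval, zero_mul, map_sub, sub_eq_zero] at h2

section

variable {G H : Type} [Group G] [Group H] {χ₀ : G → ℂ} {ψ₀ : H → ℂ}

namespace IsGagola

variable {N : Subgroup G} {p r a : ℕ}

theorem one_lt (hG : IsGagola χ₀ N p r a) : 1 < p ^ r :=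
  Nat.one_lt_pow hG.r_ne_zero hG.prime.one_lt

theorem not_dvd_sub_one (hG : IsGagola χ₀ N p r a) : ¬p ∣ p ^ r - 1 := fun h =>
  hG.prime.one_lt.ne' (Nat.dvd_one.1 ((Nat.dvd_sub_iff_right hG.one_lt.le
    (dvd_pow_self p hG.r_ne_zero)).1 h))

theorem card_sub (hG : IsGagola χ₀ N p r a) :
    (Nat.card G : ℂ) - χ₀ 1 * χ₀ 1 = ((p ^ r - 1) * p ^ (2 * a) : ℕ) := by
  have h1 : ((p ^ r - 1 : ℕ) : ℂ) = (p ^ r : ℕ) - 1 := by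
    rw [Nat.cast_sub hG.one_lt.le, Nat.cast_one]
  rw [hG.card, hG.degree]
  simp only [Nat.cast_mul, h1]
  push_cast
  ring

theorem exists_ne_one [Finite G] (hG : IsGagola χ₀ N p r a) : ∃ u ∈ N, u ≠ 1 := by
  have hN : N ≠ ⊥ := by
    rintro rfl
    have h := hG.card_subgroup
    rw [Subgroup.card_bot] at h
    exact hG.one_lt.ne h
  obtain ⟨⟨c, hcN⟩, hc⟩ := Subgroup.ne_bot_iff_exists_ne_one.1 hN
  exact ⟨c, hcN, fun h => hc (Subtype.ext h)⟩

theorem mul_comm [Finite G] (hG : IsGagola χ₀ N p r a) :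
    ∀ u ∈ N, ∀ v ∈ N, u * v = v * u := by
  have hp : Fact p.Prime := ⟨hG.prime⟩
  have hNp : IsPGroup p N := IsPGroup.iff_card.2 ⟨r, hG.card_subgroup⟩
  obtain ⟨c, hcN, hc⟩ := hG.exists_ne_one
  obtain ⟨t, -, ht1, -, ht⟩ := hNp.exists_mem_center_pow_eq_one (⊤ : Subgroup N) fun h =>
    hc (congrArg Subtype.val ((Subgroup.mem_bot (x := (⟨c, hcN⟩ : N))).1 (h ▸ Subgroup.mem_top _)))
  intro u hu v hv
  by_cases hu1 : u = 1
  · rw [hu1, one_mul, mul_one]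
  · obtain ⟨g, hg⟩ := isConj_iff.1
      (hG.isConj t t.2 u hu (fun h => ht1 (Subtype.ext h)) hu1)
    have hgv : g⁻¹ * v * g ∈ N := by
      simpa using hG.normal.conj_mem v hv g⁻¹
    have h1 : (g⁻¹ * v * g) * t = t * (g⁻¹ * v * g) := congrArg Subtype.val (ht ⟨_, hgv⟩)
    rw [← hg]
    calc g * t * g⁻¹ * v = g * (t * (g⁻¹ * v * g)) * g⁻¹ := by group
      _ = g * ((g⁻¹ * v * g) * t) * g⁻¹ := by rw [h1]
      _ = v * (g * t * g⁻¹) := by group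

theorem eq_one_of_mem_of_pow_eq_one (hG : IsGagola χ₀ N p r a) {l k : ℕ} (hl : l.Prime)
    (hlp : l ≠ p) {x : G} (hx : x ∈ N) (hxl : x ^ l ^ k = 1) : x = 1 :=
  orderOf_eq_one_iff.1 (Nat.eq_one_of_dvd_coprimes
    (((Nat.coprime_primes hl hG.prime).2 hlp).pow_left k) (orderOf_dvd_of_pow_eq_one hxl)
    (orderOf_dvd_of_pow_eq_one (hG.pow_eq_one x hx)))

theorem eq_one_of_commute (hG : IsGagola χ₀ N p r a) {l : ℕ} (hl : l.Prime) (hlp : l ≠ p)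
    {x u : G} (hxl : x ^ l = 1) (hx1 : x ≠ 1) (hu : u ∈ N) (hxu : x * u = u * x) : u = 1 := by
  have hxN : x ∉ N := fun h =>
    hx1 (hG.eq_one_of_mem_of_pow_eq_one hl hlp (k := 1) h (by rwa [pow_one]))
  obtain ⟨g, hg⟩ := isConj_iff.1 (hG.isConj_mul x hxN u hu).symm
  have h1 : (x * u) ^ l = 1 := by rw [← hg, conj_pow, hxl, mul_one, mul_inv_cancel]
  rw [Commute.mul_pow hxu, hxl, one_mul] at h1
  exact hG.eq_one_of_mem_of_pow_eq_one hl hlp (k := 1) hu (by rwa [pow_one])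

end IsGagola

namespace RowMatch

variable {Φ : {χ : G → ℂ // IsIrrChar G χ ∧ χ ≠ χ₀} ≃ {ψ : H → ℂ // IsIrrChar H ψ ∧ ψ ≠ ψ₀}}
  {σ : ConjClasses G ≃ ConjClasses H} {N : Subgroup G} {K : Subgroup H} {p r a l t b : ℕ}

theorem card_sub_eq_of_isGagola [Finite G] [Finite H] (hm : RowMatch χ₀ ψ₀ Φ σ)
    (hG : IsGagola χ₀ N p r a) (hH : IsGagola ψ₀ K l t b) :
    (p ^ r - 1) * p ^ (2 * a) = (l ^ t - 1) * l ^ (2 * b) := by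
  have h := hm.card_sub_eq
  rw [hG.card_sub, hH.card_sub] at h
  exact_mod_cast h

theorem exists_conj_eq [Finite G] [Finite H] (hm : RowMatch χ₀ ψ₀ Φ σ)
    (hG : IsGagola χ₀ N p r a) (hH : IsGagola ψ₀ K l t b) (hpl : p ≠ l) (ha : 1 ≤ a)
    {s : ℕ} {y : H} (hs : a + 1 ≤ s) (hy : orderOf y = p ^ s) :
    ∃ (g : H) (m : ℕ), ¬p ∣ m ∧ g * y * g⁻¹ = y * y ^ (p ^ (s - 1) * m) := by
  have hp := hG.prime
  set n := Nat.card G * Nat.card H with hn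
  have hn0 : n ≠ 0 := mul_ne_zero Nat.card_pos.ne' Nat.card_pos.ne'
  set m := n / p ^ n.factorization p with hmdef
  have hpm : ¬p ∣ m := Nat.not_dvd_ordCompl hp hn0
  have hnm : p ^ n.factorization p * m = n := Nat.ordProj_mul_ordCompl_eq_self n p
  set j := 1 + p ^ (s - 1) * m with hj
  have hjn : j.Coprime n := by
    have h1 : j.Coprime m := by
      rw [hj, Nat.coprime_add_mul_right_left]
      exact Nat.coprime_one_left m
    have h2 : j.Coprime p := by
      obtain ⟨i, hi⟩ : p ∣ p ^ (s - 1) * m := (dvd_pow_self p (by omega)).mul_right m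
      rw [hj, hi, Nat.coprime_add_mul_left_left]
      exact Nat.coprime_one_left p
    rw [← hnm]
    exact (h2.pow_right _).mul_right h1
  have hωn := Complex.isPrimitiveRoot_exp n hn0
  set ω := Complex.exp (2 * Real.pi * Complex.I / n) with hω
  have hχj : ∀ χ : {χ : G → ℂ // IsIrrChar G χ ∧ χ ≠ χ₀}, ∀ x : G, χ.1 (x ^ j) = χ.1 x := by
    intro χ x
    rw [hj, pow_add, pow_one, Nat.mul_comm, pow_mul]
    refine hG.apply_mul χ.1 χ.2.1 χ.2.2 _ ?_ x
    obtain ⟨i, hi⟩ := Nat.exists_eq_add_of_le (show a ≤ s - 1 by omega)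
    rw [hi, pow_add, pow_mul]
    refine pow_mem (hG.pow_mem _ (n.factorization p) ?_) _
    rw [← pow_mul, Nat.mul_comm, hnm, hn, pow_mul, pow_card_eq_one', one_pow]
  have hconj : IsConj y (y ^ j) := by
    refine isConj_of_forall_irrChar_eq fun ψ hψ => ?_
    by_cases hne : ψ = ψ₀
    · have hyK : ∀ i : ℕ, ¬p ∣ i → y ^ i ∉ K := by
        intro i hi hmem
        have h1 := hH.eq_one_of_mem_of_pow_eq_one hp hpl (k := s) hmem (by
          rw [← pow_mul, Nat.mul_comm, pow_mul, ← hy, pow_orderOf_eq_one, one_pow])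
        have h2 := orderOf_dvd_of_pow_eq_one h1
        rw [hy] at h2
        exact hi ((dvd_pow_self p (by omega)).trans h2)
      have h1 := hyK 1 (mt Nat.dvd_one.1 hp.ne_one)
      rw [pow_one] at h1
      rw [hne, hH.vanish y h1, hH.vanish _ (hyK j fun h => ?_)]
      exact hp.ne_one <| Nat.dvd_one.1 ((Nat.dvd_add_left
        ((dvd_pow_self p (by omega)).mul_right m)).1 h)
    · obtain ⟨x, hx⟩ := exists_mk_eq σ.symm y
      have hx' : σ (ConjClasses.mk x) = ConjClasses.mk y := by
        rw [← hx, σ.apply_symm_apply]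
      set χ := Φ.symm ⟨ψ, hψ, hne⟩ with hχ
      have hval : χ.1 x = ψ y := by
        rw [hm.apply_eq χ x y hx', hχ, Φ.apply_symm_apply]
      obtain ⟨f, hf⟩ := χ.2.1.exists_polynomial x
        (by rw [hn, pow_mul, pow_card_eq_one', one_pow]) hn0 hωn
      obtain ⟨g, hg⟩ := hψ.exists_polynomial y
        (by rw [hn, Nat.mul_comm, pow_mul, pow_card_eq_one', one_pow]) hn0 hωn
      have h1 := hf 1
      have h2 := hg 1
      rw [pow_one, pow_one] at h1 h2
      rw [hg j, ← hωn.aeval_pow_eq_of_coprime (Nat.pos_of_ne_zero hn0) hjn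
        (h1.symm.trans (hval.trans h2)), ← hf j, hχj χ x, hval]
  obtain ⟨g, hg⟩ := isConj_iff.1 hconj
  exact ⟨g, m, hpm, by rw [hg, hj, pow_add, pow_one]⟩

theorem false_of_isGagola [Finite G] [Finite H] (hm : RowMatch χ₀ ψ₀ Φ σ)
    (hG : IsGagola χ₀ N p r a) (hH : IsGagola ψ₀ K l t b) (hpl : p ≠ l) (ha : 1 ≤ a) : False := by
  have hp : Fact p.Prime := ⟨hG.prime⟩
  have hKn := hH.normal
  refine false_of_conj_eq_mul_pow (H := H) (p := p) ha ?_ ?_ fun s y hs hy =>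
    hm.exists_conj_eq hG hH hpl ha hs hy
  · have hcard : Nat.card H = l ^ t * ((p ^ r - 1) * p ^ (2 * a)) := by
      rw [hH.card, hm.card_sub_eq_of_isGagola hG hH]
      ring
    have h1 : ¬p ∣ l ^ t := fun h =>
      hpl ((Nat.prime_dvd_prime_iff_eq hG.prime hH.prime).1 (hG.prime.dvd_of_dvd_pow h))
    have h2 : p ^ r - 1 ≠ 0 := by
      have := hG.one_lt
      omega
    have h3 : p ^ (2 * a) ≠ 0 := pow_ne_zero _ hG.prime.ne_zero
    rw [hcard, Nat.factorization_mul (pow_ne_zero _ hH.prime.ne_zero) (mul_ne_zero h2 h3),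
      Nat.factorization_mul h2 h3, Finsupp.add_apply, Finsupp.add_apply,
      Nat.factorization_eq_zero_of_not_dvd h1,
      Nat.factorization_eq_zero_of_not_dvd hG.not_dvd_sub_one, hG.prime.factorization_pow,
      Finsupp.single_eq_same, zero_add, zero_add]
  · intro z h hz hz1 hh hhz
    exact mem_zpowers_of_commute_of_pow_eq_one hH.prime hpl hH.pow_eq_one hH.exists_ne_one
      hH.mul_comm (fun x hx hx1 u hu hxu =>
        hH.eq_one_of_commute hG.prime hpl hx hx1 hu hxu) hz hz1 hh hhz

theorem degree_eq [Finite G] [Finite H] (hm : RowMatch χ₀ ψ₀ Φ σ) : χ₀ 1 = ψ₀ 1 := by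
  by_contra hdeg
  obtain ⟨N, p, r, a, hG⟩ := hm.exists_isGagola hdeg
  obtain ⟨K, l, t, b, hH⟩ := hm.symm.exists_isGagola (Ne.symm hdeg)
  have hcard := hm.card_sub_eq_of_isGagola hG hH
  refine hdeg ?_
  rw [hG.degree, hH.degree]
  by_cases hpl : p = l
  · subst hpl
    have hab : a = b := by
      have h1 := congrArg (fun n => n.factorization p) hcard
      have h2 : p ^ r - 1 ≠ 0 := fun h => hG.not_dvd_sub_one (h ▸ dvd_zero p)
      have h3 : p ^ t - 1 ≠ 0 := fun h => hH.not_dvd_sub_one (h ▸ dvd_zero p)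
      have h4 : ∀ k, p ^ k ≠ 0 := fun k => pow_ne_zero _ hG.prime.ne_zero
      simp only [Nat.factorization_mul h2 (h4 _), Nat.factorization_mul h3 (h4 _),
        Finsupp.add_apply, Nat.factorization_eq_zero_of_not_dvd hG.not_dvd_sub_one,
        Nat.factorization_eq_zero_of_not_dvd hH.not_dvd_sub_one, hG.prime.factorization_pow,
        Finsupp.single_eq_same, zero_add] at h1
      omega
    subst hab
    rw [Nat.eq_of_mul_eq_mul_right (pow_pos hG.prime.pos _) hcard]
  · have ha : a = 0 := by
      by_contra h
      exact hm.false_of_isGagola hG hH hpl (Nat.one_le_iff_ne_zero.2 h)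
    have hb : b = 0 := by
      by_contra h
      exact hm.symm.false_of_isGagola hH hG (Ne.symm hpl) (Nat.one_le_iff_ne_zero.2 h)
    subst ha hb
    simp only [Nat.mul_zero, pow_zero, Nat.mul_one] at hcard ⊢
    rw [hcard]

end RowMatch

/-- A bijection of classes matching the tables away from one row can be corrected so that it
matches the classes of the identities. -/
theorem exists_rowMatch [Finite G] [Finite H] (hχ₀ : IsIrrChar G χ₀) (hψ₀ : IsIrrChar H ψ₀)
    (Φ : {χ : G → ℂ // IsIrrChar G χ ∧ χ ≠ χ₀} ≃ {ψ : H → ℂ // IsIrrChar H ψ ∧ ψ ≠ ψ₀})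
    (σ : ConjClasses G ≃ ConjClasses H)
    (hσ : ∀ χ c, classVal χ.1 c = classVal (Φ χ).1 (σ c)) :
    ∃ τ : ConjClasses G ≃ ConjClasses H, RowMatch χ₀ ψ₀ Φ τ := by
  classical
  have hval : ∀ χ g h, σ (ConjClasses.mk g) = ConjClasses.mk h → χ.1 g = (Φ χ).1 h := by
    intro χ g h hgh
    rw [← χ.2.1.classVal_mk, hσ, hgh, (Φ χ).2.1.classVal_mk]
  obtain ⟨c, hc⟩ := RowMatch.exists_mk_eq σ.symm 1
  obtain ⟨d, hd⟩ := RowMatch.exists_mk_eq σ 1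
  have hc' : σ (ConjClasses.mk c) = ConjClasses.mk 1 := by rw [← hc, σ.apply_symm_apply]
  have hc1 : ∀ χ : {χ : G → ℂ // IsIrrChar G χ ∧ χ ≠ χ₀}, χ.1 c = χ.1 1 := by
    intro χ
    have h1 := χ.2.1.norm_apply_le c
    have h2 := (Φ χ).2.1.norm_apply_le d
    rw [← hval χ c 1 hc', ← hval χ 1 d hd] at h2
    obtain ⟨n, -, hn⟩ := χ.2.1.exists_degree
    obtain ⟨m, -, hmm⟩ := (Φ χ).2.1.exists_degree
    rw [← hval χ c 1 hc'] at hmm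
    have h3 := le_antisymm h1 h2
    rw [hn, hmm, Complex.norm_natCast, Complex.norm_natCast] at h3
    rw [hn, hmm, Nat.cast_injective h3]
  refine ⟨(Equiv.swap (ConjClasses.mk 1) (ConjClasses.mk c)).trans σ, hχ₀, hψ₀, ?_, ?_⟩
  · intro χ g h hgh
    rw [Equiv.trans_apply, Equiv.swap_apply_def] at hgh
    split_ifs at hgh with h1 h2
    · rw [χ.2.1.apply_eq_of_isConj (ConjClasses.mk_eq_mk_iff_isConj.1 h1), ← hc1,
        hval χ c h hgh]
    · rw [χ.2.1.apply_eq_of_isConj (ConjClasses.mk_eq_mk_iff_isConj.1 h2), hc1,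
        hval χ 1 h hgh]
    · exact hval χ g h hgh
  · rw [Equiv.trans_apply, Equiv.swap_apply_left, hc']

end

/-- No two finite groups have character tables differing only in one row: if the tables
of `G` and `H` agree away from the rows of `χ₀`, `ψ₀`, then the tables are identical. -/
theorem character_tables_differ_by_one_row (G H : Type)
    [Group G] [Finite G] [Group H] [Finite H]
    (χ₀ : G → ℂ) (hχ₀ : IsIrrChar G χ₀) (ψ₀ : H → ℂ) (hψ₀ : IsIrrChar H ψ₀)
    (Φ : {χ : G → ℂ // IsIrrChar G χ ∧ χ ≠ χ₀} ≃ {ψ : H → ℂ // IsIrrChar H ψ ∧ ψ ≠ ψ₀})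
    (σ : ConjClasses G ≃ ConjClasses H)
    (hσ : ∀ (χ : {χ : G → ℂ // IsIrrChar G χ ∧ χ ≠ χ₀}) (c : ConjClasses G),
      classVal χ.1 c = classVal (Φ χ).1 (σ c)) :
    ∃ σ' : ConjClasses G ≃ ConjClasses H,
      (∀ c : ConjClasses G, classVal χ₀ c = classVal ψ₀ (σ' c)) ∧
      ∀ (χ : {χ : G → ℂ // IsIrrChar G χ ∧ χ ≠ χ₀}) (c : ConjClasses G),
        classVal χ.1 c = classVal (Φ χ).1 (σ' c) := by
  obtain ⟨τ, hτ⟩ := exists_rowMatch hχ₀ hψ₀ Φ σ hσ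
  refine ⟨τ, fun c => ?_, fun χ c => ?_⟩ <;>
    obtain ⟨g, rfl⟩ := ConjClasses.exists_rep c <;>
    obtain ⟨h, hh⟩ := RowMatch.exists_mk_eq τ g
  · rw [hh, hχ₀.classVal_mk, hψ₀.classVal_mk, hτ.apply_left_eq hτ.degree_eq hh]
  · rw [hh, χ.2.1.classVal_mk, (Φ χ).2.1.classVal_mk, hτ.apply_eq χ g h hh]
end

section
/- Let G be a finite group, let g ∈ G, and let χ be a non-trivial irreducible character of G such that χ(h) = 1 for every element h of G not conjugate to g. Then the kernel K of χ has index 2 in G, the set G \ K equals the conjugacy class of g, the centralizer of g in G has order 2, χ(1) = 1, χ(g) = −1, and every irreducible character ψ of G with ψ ∉ {1_G, χ} satisfies ψ(g) = 0. -/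
open CategoryTheory

theorem LinearMap.trace_mul_of_finrank_eq_one {V : Type*} [AddCommGroup V] [Module ℂ V]
    (hV : Module.finrank ℂ V = 1) (f f' : V →ₗ[ℂ] V) :
    LinearMap.trace ℂ V (f * f') = LinearMap.trace ℂ V f * LinearMap.trace ℂ V f' := by
  obtain ⟨a, rfl, -⟩ := f.existsUnique_eq_smul_id_of_finrank_eq_one hV
  obtain ⟨b, rfl, -⟩ := f'.existsUnique_eq_smul_id_of_finrank_eq_one hV
  have hid : (LinearMap.id : V →ₗ[ℂ] V) * LinearMap.id = LinearMap.id := rfl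
  have : FiniteDimensional ℂ V := Module.finite_of_finrank_pos (hV ▸ one_pos)
  have htr : LinearMap.trace ℂ V LinearMap.id = 1 := by rw [LinearMap.trace_id, hV, Nat.cast_one]
  simp [hid, htr, mul_comm]

theorem card_isConj_mul_card_centralizer {G : Type*} [Group G] (g : G) :
    Nat.card {x : G | IsConj g x} * Nat.card (Subgroup.centralizer ({g} : Set G)) =
      Nat.card G := by
  rw [Subgroup.nat_card_centralizer_nat_card_stabilizer,
    show {x : G | IsConj g x} = MulAction.orbit (ConjAct G) g by
      ext x; rw [ConjAct.mem_orbit_conjAct, isConj_comm]; rfl,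
    ← Nat.card_prod]
  exact Nat.card_congr (MulAction.orbitProdStabilizerEquivGroup (ConjAct G) g)

open scoped Classical in
/-- If `χ` is `1` off the conjugacy class of `g`, then summing a class function against `χ`
differs from summing it against `1` only by the contribution of that class. -/
theorem sum_mul_of_eq_one_off_class {G : Type*} [Group G] [Fintype G] {g : G} {χ ψ : G → ℂ}
    (hχ : ∀ x, IsConj g x → χ x = χ g) (hψ : ∀ x, IsConj g x → ψ x = ψ g)
    (hval : ∀ x, ¬ IsConj g x → χ x = 1) :
    ∑ x, ψ x * χ x =
      ∑ x, ψ x + Nat.card {x : G | IsConj g x} * ((χ g - 1) * ψ g) := by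
  have h (x : G) : ψ x * χ x = ψ x + if IsConj g x then (χ g - 1) * ψ g else 0 := by
    split_ifs with hx
    · rw [hχ x hx, hψ x hx]; ring
    · rw [hval x hx]; ring
  simp_rw [h, Finset.sum_add_distrib, Finset.sum_ite, Finset.sum_const_zero, add_zero,
    Finset.sum_const, nsmul_eq_mul]
  congr 2
  rw [Nat.card_eq_fintype_card, ← Set.toFinset_card, Set.toFinset_ofPred]

namespace IsIrrChar

variable {G : Type} [Group G] {χ ψ : G → ℂ}

theorem eq_of_isConj (hχ : IsIrrChar G χ) {g x : G} (h : IsConj g x) : χ x = χ g := by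
  obtain ⟨V, -, rfl⟩ := hχ
  obtain ⟨c, rfl⟩ := isConj_iff.1 h
  exact V.char_conj g c

theorem map_mul_of_map_one_eq_one (hχ : IsIrrChar G χ) (h : χ 1 = 1) (x y : G) :
    χ (x * y) = χ x * χ y := by
  obtain ⟨V, -, rfl⟩ := hχ
  rw [FDRep.char_one] at h
  simp only [FDRep.character, map_mul]
  exact LinearMap.trace_mul_of_finrank_eq_one (by exact_mod_cast h) _ _

theorem one [Finite G] : IsIrrChar G fun _ => 1 := by
  have := Fintype.ofFinite G
  have h (x : G) : (FDRep.of (Representation.trivial ℂ G ℂ)).character x = 1 := by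
    have : (Representation.trivial ℂ G ℂ) x = 1 := rfl
    simp [FDRep.character, this]
  refine ⟨FDRep.of (Representation.trivial ℂ G ℂ), ?_, funext h⟩
  rw [FDRep.simple_iff_char_is_norm_one]
  simp [h]

theorem exists_map_one_eq [Finite G] (hχ : IsIrrChar G χ) : ∃ d : ℕ, 0 < d ∧ χ 1 = d := by
  have := Fintype.ofFinite G
  obtain ⟨V, hV, rfl⟩ := hχ
  refine ⟨Module.finrank ℂ V, Nat.pos_of_ne_zero fun h0 => ?_, V.char_one⟩
  have : Subsingleton V := Module.finrank_zero_iff.1 h0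
  have hz (x : G) : V.character x = 0 := by
    rw [FDRep.character, Subsingleton.elim (V.ρ x) 0, map_zero]
  have := (FDRep.simple_iff_char_is_norm_one V).1 hV
  simp only [hz, mul_zero, Finset.sum_const_zero] at this
  exact Nat.cast_ne_zero.2 Nat.card_pos.ne' this.symm

theorem sum_mul_inv_eq_zero [Fintype G] (hψ : IsIrrChar G ψ) (hχ : IsIrrChar G χ)
    (hne : ψ ≠ χ) : ∑ x, ψ x * χ x⁻¹ = 0 := by
  obtain ⟨V, _, rfl⟩ := hψ
  obtain ⟨W, _, rfl⟩ := hχ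
  have hn : (Nat.card G : ℂ) ≠ 0 := by simp
  have := invertibleOfNonzero hn
  have h := FDRep.char_orthonormal V W
  rw [if_neg fun ⟨i⟩ => hne (FDRep.char_iso i)] at h
  exact (mul_eq_zero.1 h).resolve_left (inv_ne_zero hn)

theorem sum_eq_zero_s3 [Fintype G] (hψ : IsIrrChar G ψ) (hne : ψ ≠ fun _ => 1) :
    ∑ x, ψ x = 0 := by
  simpa using hψ.sum_mul_inv_eq_zero one hne

end IsIrrChar

/-- If a non-trivial irreducible character `χ` of a finite group `G` takes the value `1`
on every element not conjugate to `g`, then the kernel `K` of `χ` has index `2`,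
`G \ K` is the conjugacy class of `g`, `|C_G(g)| = 2`, `χ(1) = 1`, `χ(g) = -1`, and
every irreducible character `ψ ∉ {1_G, χ}` satisfies `ψ(g) = 0`. -/
theorem vanishing_off_one_class_value_one (G : Type) [Group G] [Finite G] (g : G)
    (χ : G → ℂ) (hχ : IsIrrChar G χ) (hne : χ ≠ fun _ => 1)
    (hval : ∀ h : G, ¬ IsConj g h → χ h = 1) :
    ∃ K : Subgroup G, (K : Set G) = {x : G | χ x = χ 1} ∧
      K.index = 2 ∧
      (K : Set G)ᶜ = {x : G | IsConj g x} ∧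
      Nat.card (Subgroup.centralizer ({g} : Set G)) = 2 ∧
      χ 1 = 1 ∧ χ g = -1 ∧
      ∀ ψ : G → ℂ, IsIrrChar G ψ → ψ ≠ (fun _ => 1) → ψ ≠ χ → ψ g = 0 := by
  have := Fintype.ofFinite G
  have hsum {ψ : G → ℂ} (hψ : IsIrrChar G ψ) := sum_mul_of_eq_one_off_class
    (fun x => hχ.eq_of_isConj (g := g) (x := x)) (fun _ => hψ.eq_of_isConj) hval
  have hn : (Nat.card G : ℂ) + Nat.card {x : G | IsConj g x} * (χ g - 1) = 0 := by
    simpa [hχ.sum_eq_zero_s3 hne] using (hsum IsIrrChar.one).symm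
  have hg1 : g ≠ 1 := by
    rintro rfl
    obtain ⟨d, hd, hd1⟩ := hχ.exists_map_one_eq
    have hc : Nat.card {x : G | IsConj 1 x} = 1 := by simp
    rw [hc, hd1] at hn
    have hn' : Nat.card G + d = 1 := by
      have : ((Nat.card G + d : ℕ) : ℂ) = (1 : ℕ) := by push_cast at hn ⊢; linear_combination hn
      exact_mod_cast this
    have := Nat.card_pos (α := G)
    omega
  have h1 : χ 1 = 1 := hval 1 fun h => hg1 (isConj_one_left.1 h)
  have hmul := hχ.map_mul_of_map_one_eq_one h1
  have hgne : χ g ≠ 1 := fun h => by simp [h] at hn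
  have hg0 : χ g ≠ 0 := fun h => by
    have := hmul g g⁻¹
    simp [h1, h] at this
  have hg : χ g = -1 := by
    have hgg : χ (g * g) = 1 := hval _ fun h => by
      have := hχ.eq_of_isConj h
      rw [hmul] at this
      exact hgne (mul_right_cancel₀ hg0 (by rw [this, one_mul]))
    rw [hmul] at hgg
    exact (mul_self_eq_one_iff.1 hgg).resolve_left hgne
  have hiff (x : G) : IsConj g x ↔ χ x ≠ 1 :=
    ⟨fun h => by rwa [hχ.eq_of_isConj h], fun h => by_contra fun h' => h (hval x h')⟩
  have hpm (x : G) : χ x = 1 ∨ χ x = -1 := by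
    by_cases hx : IsConj g x
    · exact .inr (by rw [hχ.eq_of_isConj hx, hg])
    · exact .inl (hval x hx)
  have hinv (x : G) : χ x⁻¹ = χ x := by
    have := hmul x x⁻¹
    rw [mul_inv_cancel, h1] at this
    rcases hpm x with h | h <;> rw [h] at this ⊢
    · linear_combination -this
    · linear_combination this
  have hcard : Nat.card G = Nat.card {x : G | IsConj g x} * 2 := by
    rw [hg] at hn
    have : (Nat.card G : ℂ) = (Nat.card {x : G | IsConj g x} * 2 : ℕ) := by
      push_cast; linear_combination hn
    exact_mod_cast this
  have hc0 : Nat.card {x : G | IsConj g x} ≠ 0 := fun h => by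
    have := Nat.card_pos (α := G)
    omega
  let F : G →* ℂ := ⟨⟨χ, h1⟩, hmul⟩
  have hF (x : G) : x ∈ F.ker ↔ χ x = 1 := Iff.rfl
  refine ⟨F.ker, ?_, ?_, ?_, ?_, h1, hg, fun ψ hψ hψ1 hψχ => ?_⟩
  · ext x
    simp [hF, h1]
  · refine Subgroup.index_eq_two_iff.2 ⟨g, fun b => ?_⟩
    rw [hF, hF, hmul, hg]
    rcases hpm b with h | h <;> rw [h] <;> norm_num [Xor]
  · ext x
    simp only [Set.mem_compl_iff, SetLike.mem_coe, hF]
    exact (hiff x).symm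
  · have := card_isConj_mul_card_centralizer g
    rw [hcard] at this
    exact Nat.eq_of_mul_eq_mul_left (Nat.pos_of_ne_zero hc0) this
  · have h := hsum hψ
    have h' := hψ.sum_mul_inv_eq_zero hχ hψχ
    simp_rw [hinv] at h'
    rw [h', hψ.sum_eq_zero_s3 hψ1, zero_add, hg, eq_comm] at h
    have hc : (Nat.card {x : G | IsConj g x} : ℂ) ≠ 0 := Nat.cast_ne_zero.2 hc0
    simpa [hc] using (by
      simpa only [mul_eq_zero, hc, false_or] using h : (-1 - 1 : ℂ) = 0 ∨ ψ g = 0).resolve_left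
        (by norm_num)
end

section
/- Let G be a finite group, let g ∈ G be a non-identity element, and let χ be a non-trivial irreducible character of G such that χ(x) = 0 for every x ∈ G not lying in {1} ∪ g^G, and χ(g) ≠ 0. Then every irreducible character ψ of G with ψ ≠ χ satisfies ψ(g) = ψ(1), the set N := {1} ∪ g^G is a minimal normal subgroup of G, and N is an elementary abelian p-group for some prime p. -/
open CategoryTheory

namespace Representation

variable {G : Type} [Group G]

/-- The trace on a representation is the sum of the traces on complementary subrepresentations. -/
theorem character_eq_add_of_isCompl {W : Type} [AddCommGroup W] [Module ℂ W]
    [FiniteDimensional ℂ W] {ρ : Representation ℂ G W} {σ τ : Subrepresentation ρ}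
    (h : IsCompl σ τ) (x : G) :
    ρ.character x = σ.toRepresentation.character x + τ.toRepresentation.character x := by
  have hc : IsCompl σ.toSubmodule τ.toSubmodule := by
    rw [isCompl_iff, disjoint_iff, codisjoint_iff]
    exact ⟨congrArg Subrepresentation.toSubmodule h.inf_eq_bot,
      congrArg Subrepresentation.toSubmodule h.sup_eq_top⟩
  let N : Bool → Submodule ℂ W := fun b => cond b σ.toSubmodule τ.toSubmodule
  have hN : DirectSum.IsInternal N :=
    (DirectSum.isInternal_submodule_iff_isCompl N (i := true) (j := false) (by simp)
      (by ext b; cases b <;> simp)).2 hc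
  have hmaps : ∀ b, Set.MapsTo (ρ x) (N b) (N b) := by
    rintro (_ | _)
    · exact fun v hv => τ.apply_mem_toSubmodule x hv
    · exact fun v hv => σ.apply_mem_toSubmodule x hv
  have := LinearMap.trace_eq_sum_trace_restrict hN hmaps
  rw [Fintype.sum_bool] at this
  exact this

/-- An irreducible complex representation of a finite group is simple in `FDRep`. -/
theorem simple_of_isIrreducible [Finite G] {W : Type} [AddCommGroup W] [Module ℂ W]
    [FiniteDimensional ℂ W] (ρ : Representation ℂ G W) [ρ.IsIrreducible] :
    Simple (FDRep.of ρ) := by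
  classical
  have := Fintype.ofFinite G
  have h0 : (Nat.card G : ℂ) ≠ 0 := by exact_mod_cast Nat.card_pos.ne'
  have := invertibleOfNonzero h0
  rw [FDRep.simple_iff_char_is_norm_one]
  have h := char_orthonormal ρ ρ
  rw [if_pos ⟨Equiv.refl ρ⟩, inv_mul_eq_one₀ h0] at h
  exact h.symm

/-- If every irreducible character other than that of `V` is constant on `K`, then on `K` every
character is a natural multiple of the character of `V` plus a natural constant. -/
theorem exists_character_eq_mul_add [Finite G] (V : FDRep ℂ G) (K : Set G)
    (hK : ∀ W : FDRep ℂ G, Simple W → W.character ≠ V.character →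
      ∀ y ∈ K, W.character y = W.character 1)
    {W : Type} [AddCommGroup W] [Module ℂ W] [FiniteDimensional ℂ W]
    (ρ : Representation ℂ G W) :
    ∃ m d : ℕ, ∀ y ∈ K, ρ.character y = m * V.character y + d := by
  induction hn : Module.finrank ℂ W using Nat.strong_induction_on generalizing W with
  | _ n ih =>
  by_cases hirr : ρ.IsIrreducible
  · by_cases hV : (FDRep.of ρ).character = V.character
    · exact ⟨1, 0, fun y _ => by rw [← hV]; simp; rfl⟩
    · refine ⟨0, Module.finrank ℂ W, fun y hy => ?_⟩
      have h1 := hK _ ρ.simple_of_isIrreducible hV y hy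
      rw [FDRep.char_one] at h1
      simpa using! h1
  · by_cases hsub : Subsingleton W
    · refine ⟨0, 0, fun y _ => ?_⟩
      rw [show ρ.character y = ρ.character 1 from
        congrArg (LinearMap.trace ℂ W) (Subsingleton.elim (ρ y) (ρ 1))]
      simp [Module.finrank_zero_of_subsingleton]
    rw [not_subsingleton_iff_nontrivial] at hsub
    have hnt : Nontrivial (Subrepresentation ρ) := ⟨⊥, ⊤, fun h => bot_ne_top (α := Submodule ℂ W)
      (congrArg Subrepresentation.toSubmodule h)⟩
    obtain ⟨σ, hσb, hσt⟩ : ∃ σ : Subrepresentation ρ, σ ≠ ⊥ ∧ σ ≠ ⊤ := by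
      by_contra! hcon
      exact hirr { eq_bot_or_eq_top := fun a => or_iff_not_imp_left.2 (hcon a) }
    have : NeZero (Nat.card G : ℂ) := ⟨by exact_mod_cast Nat.card_pos.ne'⟩
    obtain ⟨τ, hc⟩ := exists_isCompl σ
    have hτt : τ ≠ ⊤ := by
      rintro rfl
      exact hσb (by simpa using hc.inf_eq_bot)
    have key : ∀ s : Subrepresentation ρ, s ≠ ⊤ → Module.finrank ℂ s.toSubmodule < n := by
      intro s hs
      rw [← hn]
      exact Submodule.finrank_lt fun h => hs (Subrepresentation.toSubmodule_injective h)
    obtain ⟨m₁, d₁, h₁⟩ := ih _ (key σ hσt) σ.toRepresentation rfl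
    obtain ⟨m₂, d₂, h₂⟩ := ih _ (key τ hτt) τ.toRepresentation rfl
    refine ⟨m₁ + m₂, d₁ + d₂, fun y hy => ?_⟩
    rw [character_eq_add_of_isCompl hc, h₁ y hy, h₂ y hy]
    push_cast
    ring

/-- Some finite-dimensional representation has the character of the regular representation. -/
theorem exists_character_regular (G : Type) [Group G] [Finite G] :
    ∃ ρ : Representation ℂ G (G → ℂ), ∀ x ≠ 1, ρ.character x = 0 := by
  classical
  have := Fintype.ofFinite G
  refine ⟨{ toFun := fun h => LinearMap.funLeft ℂ ℂ (· * h)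
            map_one' := by ext; simp [LinearMap.funLeft]
            map_mul' := fun a b => by ext; simp [LinearMap.funLeft, mul_assoc] }, fun x hx => ?_⟩
  rw [character, LinearMap.trace_eq_matrix_trace ℂ (Pi.basisFun ℂ G), Matrix.trace]
  refine Finset.sum_eq_zero fun i _ => ?_
  simp [LinearMap.funLeft, hx]

end Representation

/-- A finite-order complex endomorphism whose trace equals the dimension is the identity. -/
theorem Module.End.eq_one_of_pow_eq_one_of_trace_eq_finrank {W : Type} [AddCommGroup W]
    [Module ℂ W] [FiniteDimensional ℂ W] (f : Module.End ℂ W) {n : ℕ} (hn : n ≠ 0)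
    (hf : f ^ n = 1) (htr : LinearMap.trace ℂ W f = Module.finrank ℂ W) : f = 1 := by
  have hroot : ∀ z ∈ f.charpoly.roots, ‖z‖ = 1 := by
    intro z hz
    have hev : f.HasEigenvalue z := by
      rw [Module.End.hasEigenvalue_iff_isRoot_charpoly]
      exact Polynomial.isRoot_of_mem_roots hz
    obtain ⟨v, hv⟩ := hev.exists_hasEigenvector
    have h1 := hv.pow_apply n
    rw [hf, Module.End.one_apply] at h1
    have h2 : (1 - z ^ n) • v = 0 := by rw [sub_smul, one_smul, ← h1, sub_self]
    have h3 := (smul_eq_zero.1 h2).resolve_right hv.2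
    exact Complex.norm_eq_one_of_pow_eq_one (sub_eq_zero.1 h3).symm hn
  have hsplit : f.charpoly.Splits := IsAlgClosed.splits _
  have hcard : f.charpoly.roots.card = Module.finrank ℂ W := by
    rw [← hsplit.natDegree_eq_card_roots, LinearMap.charpoly_natDegree]
  have hsum : (f.charpoly.roots.map fun z => 1 - z.re).sum = 0 := by
    have h := Module.End.trace_eq_sum_roots_charpoly_of_splits hsplit
    rw [htr] at h
    have h' := congrArg Complex.reAddGroupHom h
    rw [map_multiset_sum] at h'
    rw [Multiset.sum_map_sub, Multiset.map_const', Multiset.sum_replicate, hcard]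
    simp only [Complex.coe_reAddGroupHom, Complex.natCast_re] at h'
    simp [← h']
  have hone : ∀ z ∈ f.charpoly.roots, z = 1 := by
    intro z hz
    have hre : (1 : ℝ) - z.re = 0 := by
      refine Multiset.all_zero_of_le_zero_le_of_sum_eq_zero ?_ hsum _
        (Multiset.mem_map_of_mem _ hz)
      intro x hx
      obtain ⟨w, hw, rfl⟩ := Multiset.mem_map.1 hx
      linarith [Complex.re_le_norm w, hroot w hw]
    have hz1 := hroot z hz
    have hre' : z.re = 1 := by linarith
    have h4 : z.re = ‖z‖ := by rw [hre', hz1]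
    have him := (Complex.re_eq_norm.1 h4)
    exact Complex.ext hre' (by simpa using (Complex.le_def.1 him).2.symm)
  have hcp : f.charpoly = (Polynomial.X - Polynomial.C 1) ^ Module.finrank ℂ W := by
    rw [hsplit.eq_prod_roots_of_monic f.charpoly_monic,
      Multiset.eq_replicate.2 ⟨hcard, hone⟩]
    simp
  have hnil : IsNilpotent (f - 1) := by
    refine ⟨Module.finrank ℂ W, ?_⟩
    have := f.aeval_self_charpoly
    simpa [hcp] using this
  have hss : f.IsSemisimple := by
    refine Module.End.isSemisimple_of_squarefree_aeval_eq_zero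
      (p := Polynomial.X ^ n - Polynomial.C 1) ?_ (by simp [hf])
    exact (Polynomial.separable_X_pow_sub_C 1 (by exact_mod_cast hn) one_ne_zero).squarefree
  have hss' : (f - 1).IsSemisimple := by
    have := (Module.End.isSemisimple_sub_algebraMap_iff (f := f) (μ := (1 : ℂ))).2 hss
    simpa using this
  exact sub_eq_zero.1 (Module.End.eq_zero_of_isNilpotent_isSemisimple hnil hss')

/-- Two irreducible characters of a finite group which differ are orthogonal. -/
theorem FDRep.sum_character_mul_character_inv_eq_zero {G : Type} [Group G] [Fintype G]
    (V W : FDRep ℂ G) [Simple V] [Simple W] (h : W.character ≠ V.character) :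
    ∑ x : G, V.character x * W.character x⁻¹ = 0 := by
  classical
  have h0 : (Nat.card G : ℂ) ≠ 0 := by exact_mod_cast Nat.card_pos.ne'
  have := invertibleOfNonzero h0
  have h1 := FDRep.char_orthonormal V W
  rw [if_neg fun ⟨i⟩ => h (FDRep.char_iso i).symm] at h1
  exact (mul_eq_zero.1 h1).resolve_left (inv_ne_zero h0)

/-- The trivial character is irreducible. -/
theorem exists_simple_character_eq_one (G : Type) [Group G] [Finite G] :
    ∃ T : FDRep ℂ G, Simple T ∧ T.character = fun _ => 1 := by
  have := Fintype.ofFinite G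
  have h : (FDRep.of (Representation.trivial ℂ G ℂ)).character = fun _ => 1 := by
    ext x
    rw [FDRep.character, FDRep.of_ρ',
      show Representation.trivial ℂ G ℂ x = LinearMap.id from rfl]
    exact (LinearMap.trace_id ℂ ℂ).trans (by simp)
  refine ⟨_, ?_, h⟩
  rw [FDRep.simple_iff_char_is_norm_one, h]
  simp

/-- A group element at which a complex character takes the degree as value acts trivially. -/
theorem FDRep.rho_eq_one_of_character_eq {G : Type} [Group G] [Finite G] (W : FDRep ℂ G) {x : G}
    (h : W.character x = W.character 1) : W.ρ x = 1 := by
  refine Module.End.eq_one_of_pow_eq_one_of_trace_eq_finrank (W.ρ x) (n := orderOf x)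
    (orderOf_pos x).ne' ?_ ?_
  · rw [← map_pow, pow_orderOf_eq_one, map_one]
  · rw [← FDRep.char_one]
    exact h

section Group

variable {G : Type} [Group G]

/-- A normal subgroup consisting of `1` and one conjugacy class is a minimal normal subgroup. -/
theorem Subgroup.eq_bot_or_eq_of_coe_eq_conj {g : G} {N : Subgroup G}
    (hN : (N : Set G) = {1} ∪ {y | IsConj g y}) {M : Subgroup G} (hM : M.Normal) (hMN : M ≤ N) :
    M = ⊥ ∨ M = N := by
  refine or_iff_not_imp_left.2 fun hbot => le_antisymm hMN fun y hy => ?_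
  obtain ⟨z, hzM, hz1⟩ := M.bot_or_exists_ne_one.resolve_left hbot
  have hz : z ∈ (N : Set G) := hMN hzM
  rw [← SetLike.mem_coe, hN] at hy
  rw [hN] at hz
  rcases hy with rfl | hy
  · exact M.one_mem
  · obtain ⟨c, rfl⟩ := isConj_iff.1 ((hz.resolve_left hz1).symm.trans hy)
    exact hM.conj_mem z hzM c

/-- A normal subgroup of a finite group consisting of `1` and one nontrivial conjugacy class is
elementary abelian. -/
theorem Subgroup.exists_prime_of_coe_eq_conj [Finite G] {g : G} (hg : g ≠ 1) {N : Subgroup G}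
    [hNn : N.Normal] (hN : (N : Set G) = {1} ∪ {y | IsConj g y}) :
    ∃ p : ℕ, p.Prime ∧ (∀ x y : G, x ∈ N → y ∈ N → x * y = y * x) ∧
      (∀ x ∈ N, x ≠ 1 → orderOf x = p) := by
  have hmem : ∀ x, x ∈ N ↔ x = 1 ∨ IsConj g x := fun x => by
    rw [← SetLike.mem_coe, hN]; rfl
  have hgN : g ∈ N := (hmem g).2 (.inr (.refl g))
  have hord : ∀ x ∈ N, x ≠ 1 → orderOf x = orderOf g := by
    intro x hx hx1
    obtain ⟨c, rfl⟩ := isConj_iff.1 (((hmem x).1 hx).resolve_left hx1)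
    exact MulEquiv.orderOf_eq (MulAut.conj c) g
  have hp : (orderOf g).Prime := by
    obtain ⟨p, hp, hpd⟩ := Nat.exists_prime_and_dvd (mt orderOf_eq_one_iff.1 hg)
    have h1 := orderOf_pow_orderOf_div (orderOf_pos g).ne' hpd
    rw [← hord _ (N.pow_mem hgN _) fun h => hp.ne_one (by rw [← h1, h, orderOf_one]), h1]
    exact hp
  refine ⟨orderOf g, hp, fun x y hx hy => ?_, hord⟩
  have := Fact.mk hp
  have hpg : IsPGroup (orderOf g) N := by
    refine fun x => ⟨1, Subtype.ext ?_⟩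
    rw [pow_one]
    by_cases hx1 : (x : G) = 1
    · simp [hx1]
    · simpa [hord x x.2 hx1] using pow_orderOf_eq_one (x : G)
  have : Nontrivial N := ⟨⟨g, hgN⟩, 1, fun h => hg (congrArg Subtype.val h)⟩
  have := hpg.center_nontrivial
  obtain ⟨⟨⟨z, hzN⟩, hzc⟩, hz1⟩ := exists_ne (1 : Subgroup.center N)
  have hz1' : z ≠ 1 := fun h => hz1 (Subtype.ext (Subtype.ext h))
  rcases (hmem x).1 hx with rfl | hx'
  · simp
  obtain ⟨c, rfl⟩ := isConj_iff.1 ((((hmem z).1 hzN).resolve_left hz1').symm.trans hx')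
  have hy' : c⁻¹ * y * c ∈ N := by simpa using hNn.conj_mem y hy c⁻¹
  have hcomm : c⁻¹ * y * c * z = z * (c⁻¹ * y * c) :=
    congrArg Subtype.val (Subgroup.mem_center_iff.1 hzc ⟨_, hy'⟩)
  calc c * z * c⁻¹ * y = c * (z * (c⁻¹ * y * c)) * c⁻¹ := by group
    _ = c * (c⁻¹ * y * c * z) * c⁻¹ := by rw [hcomm]
    _ = y * (c * z * c⁻¹) := by group

end Group

/-- The subgroup of elements acting trivially in all irreducible representations whose character
is not `χ`. -/
def kerOtherIrr (G : Type) [Group G] (χ : G → ℂ) : Subgroup G where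
  carrier := {x | ∀ W : FDRep ℂ G, Simple W → W.character ≠ χ → W.ρ x = 1}
  one_mem' W _ _ := map_one W.ρ
  mul_mem' ha hb W hW hχ := by rw [map_mul, ha W hW hχ, hb W hW hχ, one_mul]
  inv_mem' {a} ha W hW hχ := by
    have h : W.ρ a⁻¹ * W.ρ a = 1 := by rw [← map_mul, inv_mul_cancel, map_one]
    rwa [ha W hW hχ, mul_one] at h

instance kerOtherIrr_normal (G : Type) [Group G] (χ : G → ℂ) : (kerOtherIrr G χ).Normal where
  conj_mem a ha c W hW hχ := by
    rw [map_mul, map_mul, ha W hW hχ, mul_one, ← map_mul, mul_inv_cancel, map_one]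

theorem character_eq_of_mem_kerOtherIrr {G : Type} [Group G] {χ : G → ℂ} {x : G}
    (hx : x ∈ kerOtherIrr G χ) {W : FDRep ℂ G} (hW : Simple W) (hχ : W.character ≠ χ) :
    W.character x = W.character 1 :=
  congrArg (LinearMap.trace ℂ W) ((hx W hW hχ).trans (map_one W.ρ).symm)

/-- A nontrivial irreducible character whose support lies in the common kernel of the other
irreducible characters does not vanish on that kernel. -/
theorem character_ne_zero_of_mem_kerOtherIrr {G : Type} [Group G] [Finite G] (V : FDRep ℂ G)
    [Simple V] (hne : V.character ≠ fun _ => 1)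
    (hsupp : ∀ x ∉ kerOtherIrr G V.character, V.character x = 0) {x : G}
    (hx : x ∈ kerOtherIrr G V.character) : V.character x ≠ 0 := by
  classical
  have := Fintype.ofFinite G
  rcases eq_or_ne x 1 with rfl | hx1
  · intro h0
    have h := (FDRep.simple_iff_char_is_norm_one V).1 inferInstance
    have hz : ∀ y, V.character y = 0 := by
      rw [FDRep.char_one, Nat.cast_eq_zero] at h0
      have := Module.finrank_zero_iff.1 h0
      exact fun y => (congrArg (LinearMap.trace ℂ V)
        (Subsingleton.elim (V.ρ y) 0)).trans (map_zero _)
    simp [hz, eq_comm, Fintype.card_ne_zero] at h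
  intro h0
  obtain ⟨ρ, hρ⟩ := Representation.exists_character_regular G
  obtain ⟨m, d, hmd⟩ := Representation.exists_character_eq_mul_add V (kerOtherIrr G V.character)
    (fun W hW hWV y hy =>
      character_eq_of_mem_kerOtherIrr hy hW hWV) ρ
  have hd : d = 0 := by
    have h := hmd x hx
    rw [hρ x hx1, h0] at h
    simpa using h.symm
  obtain ⟨T, hT, hTc⟩ := exists_simple_character_eq_one G
  have hsum : ∑ y : G, V.character y = 0 := by
    have h := V.sum_character_mul_character_inv_eq_zero T (hTc ▸ hne.symm)
    simpa [hTc] using h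
  have hreg : ∑ y : G, (m : ℂ) * V.character y = ρ.character 1 := by
    rw [Finset.sum_eq_single 1]
    · simpa [hd] using (hmd 1 (one_mem _)).symm
    · intro y _ hy1
      by_cases hy : y ∈ kerOtherIrr G V.character
      · simpa [hd, hρ y hy1] using hmd y hy
      · rw [hsupp y hy, mul_zero]
    · simp
  rw [← Finset.mul_sum, hsum, mul_zero, Representation.char_one] at hreg
  simp [eq_comm, Fintype.card_ne_zero] at hreg

/-- If `V` is nontrivial irreducible and its character vanishes off `1` and the class of `g`, but
not at `g`, then `g` acts trivially in every other irreducible representation. -/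
theorem mem_kerOtherIrr {G : Type} [Group G] [Finite G] {g : G} (hg : g ≠ 1) (V : FDRep ℂ G)
    [Simple V] (hne : V.character ≠ fun _ => 1)
    (hvan : ∀ x : G, x ∉ ({1} ∪ {y | IsConj g y} : Set G) → V.character x = 0)
    (hgval : V.character g ≠ 0) : g ∈ kerOtherIrr G V.character := by
  classical
  have := Fintype.ofFinite G
  have hconj : ∀ (W : FDRep ℂ G) {x : G}, IsConj g x →
      W.character x = W.character g ∧ W.character x⁻¹ = W.character g⁻¹ := by
    intro W x hx
    obtain ⟨c, rfl⟩ := isConj_iff.1 hx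
    exact ⟨W.char_conj g c, by rw [← W.char_conj g⁻¹ c]; congr 1; group⟩
  have hsum : ∀ W : FDRep ℂ G, Simple W → W.character ≠ V.character →
      V.character 1 * W.character 1 +
        (Finset.univ.filter (IsConj g)).card * (V.character g * W.character g⁻¹) = 0 := by
    intro W hW hWV
    rw [← V.sum_character_mul_character_inv_eq_zero W hWV, ← Finset.add_sum_erase _ _
      (Finset.mem_univ (1 : G)), inv_one, ← nsmul_eq_mul, ← Finset.sum_const]
    congr 1
    refine (Finset.sum_congr rfl fun x hx => ?_).trans (Finset.sum_subset ?_ ?_)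
    · obtain ⟨h1, h2⟩ := hconj V (Finset.mem_filter.1 hx).2
      rw [h1, (hconj W (Finset.mem_filter.1 hx).2).2]
    · intro x hx
      refine Finset.mem_erase.2 ⟨?_, Finset.mem_univ x⟩
      rintro rfl
      exact hg (isConj_one_left.1 (Finset.mem_filter.1 hx).2)
    · intro x hx hx'
      rw [hvan x, zero_mul]
      rintro (h | h)
      · exact (Finset.mem_erase.1 hx).1 h
      · exact hx' (Finset.mem_filter.2 ⟨Finset.mem_univ x, h⟩)
  obtain ⟨T, hT, hTc⟩ := exists_simple_character_eq_one G
  have hT0 := hsum T hT (hTc ▸ hne.symm)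
  rw [hTc] at hT0
  have hV1 : V.character 1 ≠ 0 := by
    intro h0
    rw [h0, zero_mul, zero_add, mul_one, mul_eq_zero] at hT0
    have hcard : (Finset.univ.filter (IsConj g)).card ≠ 0 :=
      Finset.card_ne_zero_of_mem (Finset.mem_filter.2 ⟨Finset.mem_univ g, .refl g⟩)
    exact hT0.elim (by exact_mod_cast hcard) hgval
  suffices h : g⁻¹ ∈ kerOtherIrr G V.character from inv_mem_iff.1 h
  intro W hW hWV
  refine W.rho_eq_one_of_character_eq (mul_left_cancel₀ hV1 ?_)
  linear_combination W.character g⁻¹ * hT0 - hsum W hW hWV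

/-- If a non-trivial irreducible character `χ` of a finite group `G` vanishes outside
`{1} ∪ g^G` and `χ(g) ≠ 0` (with `g ≠ 1`), then every other irreducible character `ψ`
satisfies `ψ(g) = ψ(1)`, and `N = {1} ∪ g^G` is a minimal normal subgroup of `G` which
is an elementary abelian `p`-group for some prime `p`. -/
theorem vanishing_off_one_class (G : Type) [Group G] [Finite G] (g : G) (hg : g ≠ 1)
    (χ : G → ℂ) (hχ : IsIrrChar G χ) (hne : χ ≠ fun _ => 1)
    (hvan : ∀ x : G, x ∉ ({1} ∪ {y | IsConj g y} : Set G) → χ x = 0)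
    (hgval : χ g ≠ 0) :
    (∀ ψ : G → ℂ, IsIrrChar G ψ → ψ ≠ χ → ψ g = ψ 1) ∧
    ∃ (N : Subgroup G) (p : ℕ),
      (N : Set G) = ({1} ∪ {y | IsConj g y} : Set G) ∧
      N.Normal ∧ N ≠ ⊥ ∧
      (∀ M : Subgroup G, M.Normal → M ≤ N → M = ⊥ ∨ M = N) ∧
      p.Prime ∧
      (∀ x y : G, x ∈ N → y ∈ N → x * y = y * x) ∧
      (∀ x ∈ N, x ≠ 1 → orderOf x = p) := by
  obtain ⟨V, hV, rfl⟩ := hχ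
  have hgK := mem_kerOtherIrr hg V hne hvan hgval
  have hle : ∀ x ∈ ({1} ∪ {y | IsConj g y} : Set G), x ∈ kerOtherIrr G V.character := by
    rintro x (rfl | hx)
    · exact one_mem _
    · obtain ⟨c, rfl⟩ := isConj_iff.1 hx
      exact (kerOtherIrr_normal G V.character).conj_mem g hgK c
  have hK : (kerOtherIrr G V.character : Set G) = {1} ∪ {y | IsConj g y} := by
    refine Set.Subset.antisymm (fun x hx => ?_) hle
    by_contra hxC
    exact character_ne_zero_of_mem_kerOtherIrr V hne (fun y hy => hvan y fun h => hy (hle y h)) hx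
      (hvan x hxC)
  refine ⟨?_, ?_⟩
  · rintro ψ ⟨W, hW, rfl⟩ hψ
    exact character_eq_of_mem_kerOtherIrr hgK hW hψ
  · obtain ⟨p, hp, hcomm, hord⟩ := Subgroup.exists_prime_of_coe_eq_conj hg hK
    exact ⟨_, p, hK, inferInstance, fun h => hg ((Subgroup.eq_bot_iff_forall _).1 h g hgK),
      fun M hM hMN => Subgroup.eq_bot_or_eq_of_coe_eq_conj hK hM hMN, hp, hcomm, hord⟩
end

section
/- Let G be a finite group, let g ∈ G be a non-identity element, and let χ be a non-trivial irreducible character of G such that χ(x) = 0 for every x ∈ G not lying in {1} ∪ g^G, and χ(g) ≠ 0. Let N := {1} ∪ g^G (a normal subgroup of G which is an elementary abelian p-group for some prime p). Write d = χ(1). Then d_{p'} = |G : N|_{p'} and d_p² = |G : N|_p, where p is the prime such that N is a p-group. -/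
open CategoryTheory

open Module in
/-- Character values of a finite group are algebraic integers. -/
theorem FDRep.isIntegral_character {G : Type} [Group G] [Finite G] (V : FDRep ℂ G) (x : G) :
    IsIntegral ℤ (V.character x) := by
  rw [FDRep.character, End.trace_eq_sum_roots_charpoly_of_splits (IsAlgClosed.splits _)]
  refine IsIntegral.multiset_sum fun μ hμ => ?_
  have hroot := (Polynomial.mem_roots'.1 hμ).2
  obtain ⟨v, hv⟩ := ((End.hasEigenvalue_iff_isRoot_charpoly (V.ρ x) μ).2 hroot).exists_hasEigenvector
  have hpow : μ ^ Nat.card G = 1 := by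
    have h := hv.pow_apply (Nat.card G)
    rw [← map_pow, pow_card_eq_one', map_one, End.one_apply] at h
    exact smul_left_injective ℂ hv.2 (by simpa using h.symm)
  exact IsIntegral.of_pow Nat.card_pos (hpow ▸ isIntegral_one)

/-- The values of a non-trivial irreducible character sum to zero. -/
theorem FDRep.sum_character_eq_zero {G : Type} [Group G] [Fintype G] (V : FDRep ℂ G) [Simple V]
    (hV : V.character ≠ fun _ => 1) : ∑ x, V.character x = 0 := by
  have : Invertible (Nat.card G : ℂ) := invertibleOfNonzero (by simp)
  let T : FDRep ℂ G := FDRep.of (Representation.trivial ℂ G ℂ)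
  have hT : T.character = fun _ => 1 := by
    ext x
    change LinearMap.trace ℂ ℂ (Representation.trivial ℂ G ℂ x) = 1
    rw [show Representation.trivial ℂ G ℂ x = 1 from rfl, LinearMap.trace_one]
    simp
  have : Simple T := (FDRep.simple_iff_char_is_norm_one T).2 (by simp [hT])
  have h := FDRep.char_orthonormal V T
  rw [if_neg fun ⟨i⟩ => hV ((FDRep.char_iso i).trans hT)] at h
  simpa [hT] using h

/-- If a character vanishes on the non-identity elements of a subgroup, then the order of the
subgroup divides the degree. -/
theorem FDRep.card_dvd_finrank {G : Type} [Group G] [Finite G] (V : FDRep ℂ G) (H : Subgroup G)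
    (hV : ∀ x ∈ H, x ≠ 1 → V.character x = 0) : Nat.card H ∣ Module.finrank ℂ V := by
  have := Fintype.ofFinite H
  have : Invertible (Nat.card H : ℂ) := invertibleOfNonzero (by simp)
  have h := Representation.card_inv_mul_sum_char_eq_finrank (V.ρ.comp H.subtype)
  have hchar : ∀ x : H, Representation.character (V.ρ.comp H.subtype) x = V.character x :=
    fun _ => rfl
  rw [Finset.sum_eq_single 1 (fun x _ hx => by
    rw [hchar]; exact hV x x.2 (by simpa using hx)) (by simp), hchar, Subgroup.coe_one,
    FDRep.char_one, inv_mul_eq_iff_eq_mul₀ (by simp)] at h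
  exact ⟨_, by exact_mod_cast h⟩

/-- The sum of a function supported on a subgroup and constant on its non-identity elements. -/
theorem Subgroup.sum_eq_of_const {G : Type*} [Group G] [Fintype G] (N : Subgroup G) (f : G → ℂ)
    (c : ℂ) (hout : ∀ x ∉ N, f x = 0) (hin : ∀ x ∈ N, x ≠ 1 → f x = c) :
    ∑ x, f x = f 1 + (Nat.card N - 1) * c := by
  classical
  have hf : ∀ x, f x = (if x = 1 then f 1 - c else 0) + if x ∈ N then c else 0 := by
    intro x
    by_cases h1 : x = 1
    · subst h1; simp
    · by_cases hx : x ∈ N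
      · simp [h1, hx, hin x hx h1]
      · simp [h1, hx, hout x hx]
  have hN : (Finset.univ.filter (· ∈ N)).card = Nat.card N := by
    rw [← Fintype.card_subtype, Nat.card_eq_fintype_card]
  rw [Finset.sum_congr rfl fun x _ => hf x, Finset.sum_add_distrib, Finset.sum_ite_eq',
    ← Finset.sum_filter, Finset.sum_const, nsmul_eq_mul, hN, if_pos (Finset.mem_univ _)]
  ring

/-- If `d + s c = 0` and `d² + s c² = m (s + 1)` with `c` a nonzero algebraic integer, then `d` and
`m` are `s e` and `s e²` for a positive integer `e`. -/
theorem exists_eq_mul_of_isIntegral {d s m : ℕ} (hs : 0 < s) {c : ℂ} (hc : IsIntegral ℤ c)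
    (hc0 : c ≠ 0) (h₁ : (d : ℂ) + s * c = 0) (h₂ : (d : ℂ) ^ 2 + s * c ^ 2 = m * (s + 1)) :
    ∃ e, 0 < e ∧ d = s * e ∧ m = s * e ^ 2 := by
  have hs' : (s : ℂ) ≠ 0 := by exact_mod_cast hs.ne'
  have hcq : c = algebraMap ℚ ℂ (-d / s) := by
    simp only [map_div₀, map_neg, map_natCast]
    field_simp
    linear_combination h₁
  rw [hcq, isIntegral_algebraMap_iff (algebraMap ℚ ℂ).injective] at hc
  obtain ⟨k, hk⟩ := IsIntegrallyClosed.isIntegral_iff.1 hc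
  have hck : c = k := by rw [hcq, ← hk]; simp
  subst hck
  have hd : (d : ℤ) = s * -k := by
    have : (d : ℤ) + s * k = 0 := by exact_mod_cast h₁
    linarith
  have hm : (d : ℤ) ^ 2 + s * k ^ 2 = m * (s + 1) := by exact_mod_cast h₂
  have hk0 : k ≠ 0 := by simpa using hc0
  have hkneg : k ≤ 0 := by
    by_contra! h
    nlinarith [mul_pos (Int.natCast_pos.2 hs) h]
  obtain ⟨e, he⟩ := Int.eq_ofNat_of_zero_le (neg_nonneg.2 hkneg)
  obtain rfl : k = -e := by linarith
  refine ⟨e, by grind, by rw [neg_neg] at hd; exact_mod_cast hd, ?_⟩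
  have : (m : ℤ) * (s + 1) = (s * e ^ 2) * (s + 1) := by rw [← hm, hd]; ring
  exact_mod_cast mul_right_cancel₀ (by positivity) this

/-- In the situation of a non-trivial irreducible character `χ` of degree `d` vanishing
outside `{1} ∪ g^G` with `χ(g) ≠ 0`, where `N = {1} ∪ g^G` is a normal elementary
abelian `p`-subgroup, one has `d_{p'} = |G : N|_{p'}` and `d_p² = |G : N|_p`. -/
theorem vanishing_off_one_class_p_parts (G : Type) [Group G] [Finite G] (g : G) (hg : g ≠ 1)
    (χ : G → ℂ) (hχ : IsIrrChar G χ) (hne : χ ≠ fun _ => 1)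
    (hvan : ∀ x : G, x ∉ ({1} ∪ {y | IsConj g y} : Set G) → χ x = 0)
    (hgval : χ g ≠ 0)
    (N : Subgroup G) (hN : (N : Set G) = ({1} ∪ {y | IsConj g y} : Set G))
    (hNnormal : N.Normal)
    (p : ℕ) (hp : p.Prime)
    (hab : ∀ x y : G, x ∈ N → y ∈ N → x * y = y * x)
    (helem : ∀ x ∈ N, x ≠ 1 → orderOf x = p)
    (d : ℕ) (hd : χ 1 = (d : ℂ)) :
    d / p ^ (d.factorization p) = N.index / p ^ ((N.index).factorization p) ∧
    (p ^ (d.factorization p)) ^ 2 = p ^ ((N.index).factorization p) := by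
  have := Fintype.ofFinite G
  obtain ⟨V, hV, rfl⟩ := hχ
  have hout : ∀ x ∉ N, V.character x = 0 := fun x hx => hvan x (by rwa [← hN])
  have hin : ∀ x ∈ N, x ≠ 1 → V.character x = V.character g := by
    intro x hx hx1
    have hx' : x ∈ ({1} ∪ {y | IsConj g y} : Set G) := hN ▸ hx
    obtain ⟨a, rfl⟩ := isConj_iff.1 (hx'.resolve_left hx1)
    exact V.char_conj g a
  have hgN : g ∈ N := by
    rw [← SetLike.mem_coe, hN]
    exact Or.inr (IsConj.refl g)
  obtain ⟨s, hs⟩ : ∃ s, Nat.card N = s + 1 := Nat.exists_eq_add_one.2 Nat.card_pos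
  have hps : p ∣ s + 1 := by
    rw [← hs, ← helem g hgN hg]
    exact Subgroup.orderOf_dvd_natCard N hgN
  have hs0 : 0 < s := by
    have := hp.two_le
    have := Nat.le_of_dvd (by simp) hps
    omega
  have hsum := N.sum_eq_of_const V.character _ hout hin
  have hnorm := N.sum_eq_of_const (fun x => V.character x * V.character x⁻¹)
    (V.character g ^ 2) (fun x hx => by simp [hout x hx])
    (fun x hx hx1 => by
      rw [hin x hx hx1, hin x⁻¹ (N.inv_mem hx) (by simpa using hx1), sq])
  rw [V.sum_character_eq_zero hne] at hsum
  rw [(FDRep.simple_iff_char_is_norm_one V).1 hV, ← N.index_mul_card] at hnorm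
  simp only [inv_one, hd, hs, Nat.cast_add, Nat.cast_mul, Nat.cast_one,
    add_sub_cancel_right] at hsum hnorm
  obtain ⟨e, he0, rfl, hm⟩ := exists_eq_mul_of_isIntegral hs0 (V.isIntegral_character g) hgval
    hsum.symm (by rw [hnorm]; ring)
  have hd0 : s * e ≠ 0 := by positivity
  have hm0 : N.index ≠ 0 := Subgroup.index_ne_zero_of_finite
  have hdeg : Module.finrank ℂ V = s * e := by
    rw [FDRep.char_one] at hd
    exact_mod_cast hd
  have hpp : 2 * (s * e).factorization p = N.index.factorization p := by
    have hs_p : s.factorization p = 0 := Nat.factorization_eq_zero_of_not_dvd fun h =>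
      hp.one_lt.ne' (Nat.dvd_one.1 ((Nat.dvd_add_right h).1 hps))
    rw [hm, Nat.factorization_mul hs0.ne' he0.ne', Nat.factorization_mul hs0.ne' (by positivity),
      Nat.factorization_pow]
    simp [hs_p]
  refine ⟨Nat.eq_of_factorization_eq (Nat.ordCompl_pos p hd0).ne' (Nat.ordCompl_pos p hm0).ne'
    fun r => ?_, by rw [← pow_mul, mul_comm, hpp]⟩
  rw [Nat.factorization_ordCompl, Nat.factorization_ordCompl]
  by_cases hrp : r = p
  · simp [hrp]
  rw [Finsupp.erase_ne hrp, Finsupp.erase_ne hrp]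
  by_cases hr : r.Prime
  swap
  · simp [Nat.factorization_eq_zero_of_not_prime _ hr]
  refine le_antisymm ((Nat.factorization_le_iff_dvd hd0 hm0).2 ⟨e, by rw [hm]; ring⟩ r) ?_
  have : Fact r.Prime := ⟨hr⟩
  obtain ⟨R⟩ : Nonempty (Sylow r G) := inferInstance
  have hR := V.card_dvd_finrank R fun x hx hx1 => hout x fun hxN => by
    obtain ⟨k, hk⟩ := R.2.exists_orderOf_eq_pow ⟨x, hx⟩
    rw [Subgroup.orderOf_mk, helem x hxN hx1] at hk
    exact hrp ((Nat.prime_dvd_prime_iff_eq hp hr).1 (hp.dvd_of_dvd_pow hk.dvd)).symm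
  rw [hdeg, R.card_eq_multiplicity, hr.pow_dvd_iff_le_factorization hd0] at hR
  exact ((Nat.factorization_le_iff_dvd hm0 Nat.card_pos.ne').2 N.index_dvd_card r).trans hR
end
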